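/- Let β ∈ ℝ, t ∈ (0,1] and ε ∈ (0,1), and let I_ε = [-1,-ε] ∪ [ε,1]. Then there exists a constant K > 0 such that limsup_{n→∞} ( (1/n) E[log Z^{I_ε}_{g,g_t}] − (1/n) E[log Z^{[-1,1]}_{g,g_t}] ) ≤ −1/K. -/

import Mathlib

open MeasureTheory ProbabilityTheory Filter

noncomputable section

/-- The value of a ±1 spin encoded as a Boolean. -/
def spin (b : Bool) : ℝ := if b then 1 else -1

/-- The Ising Hamiltonian `H(σ; X) = ∑_{i,j} X i j σ(i) σ(j)`. -/
def Ham {n : ℕ} (X : Fin n → Fin n → ℝ) (σ : Fin n → Bool) : ℝ :=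
  ∑ i, ∑ j, X i j * spin (σ i) * spin (σ j)

/-- The partition function `Z(β, X)`. -/
def Zpart {n : ℕ} (β : ℝ) (X : Fin n → Fin n → ℝ) : ℝ :=
  ∑ σ : Fin n → Bool, Real.exp (-β * Ham X σ)

/-- The Gibbs probability mass function `μ_{β,X}(σ)`. -/
def gibbs {n : ℕ} (β : ℝ) (X : Fin n → Fin n → ℝ) (σ : Fin n → Bool) : ℝ :=
  Real.exp (-β * Ham X σ) / Zpart β X

/-- A configuration is a bisection if `|∑ i σ(i)| ≤ 1`. -/
def isBis {n : ℕ} (σ : Fin n → Bool) : Prop := |∑ i, spin (σ i)| ≤ 1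

open scoped Classical in
/-- The bisection partition function `Z^bis(β, X)`. -/
def ZpartBis {n : ℕ} (β : ℝ) (X : Fin n → Fin n → ℝ) : ℝ :=
  ∑ σ : Fin n → Bool, if isBis σ then Real.exp (-β * Ham X σ) else 0

open scoped Classical in
/-- The bisection Gibbs probability mass function `μ^bis_{β,X}(σ)`. -/
def gibbsBis {n : ℕ} (β : ℝ) (X : Fin n → Fin n → ℝ) (σ : Fin n → Bool) : ℝ :=
  if isBis σ then Real.exp (-β * Ham X σ) / ZpartBis β X else 0

/-- The overlap `R_{1,2}(σ1, σ2) = (1/n) ∑ i σ1(i) σ2(i)`. -/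
def overlap {n : ℕ} (σ1 σ2 : Fin n → Bool) : ℝ :=
  (1 / (n : ℝ)) * ∑ i, spin (σ1 i) * spin (σ2 i)

/-- Gibbs average of a one-variable observable. -/
def avg1 {n : ℕ} (β : ℝ) (X : Fin n → Fin n → ℝ) (f : (Fin n → Bool) → ℝ) : ℝ :=
  ∑ σ : Fin n → Bool, f σ * gibbs β X σ

/-- Bisection Gibbs average of a one-variable observable. -/
def avg1Bis {n : ℕ} (β : ℝ) (X : Fin n → Fin n → ℝ) (f : (Fin n → Bool) → ℝ) : ℝ :=
  ∑ σ : Fin n → Bool, f σ * gibbsBis β X σ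

/-- Coupled Gibbs average: `σ1 ~ μ_{β,X}`, `σ2 ~ μ_{β,Y}` independent. -/
def avg2c {n : ℕ} (β : ℝ) (X Y : Fin n → Fin n → ℝ)
    (f : (Fin n → Bool) → (Fin n → Bool) → ℝ) : ℝ :=
  ∑ σ1 : Fin n → Bool, ∑ σ2 : Fin n → Bool, f σ1 σ2 * gibbs β X σ1 * gibbs β Y σ2

/-- Gibbs average of a two-replica observable. -/
def avg2 {n : ℕ} (β : ℝ) (X : Fin n → Fin n → ℝ)
    (f : (Fin n → Bool) → (Fin n → Bool) → ℝ) : ℝ :=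
  avg2c β X X f

/-- Coupled bisection Gibbs average. -/
def avg2cBis {n : ℕ} (β : ℝ) (X Y : Fin n → Fin n → ℝ)
    (f : (Fin n → Bool) → (Fin n → Bool) → ℝ) : ℝ :=
  ∑ σ1 : Fin n → Bool, ∑ σ2 : Fin n → Bool, f σ1 σ2 * gibbsBis β X σ1 * gibbsBis β Y σ2

/-- Bisection Gibbs average of a two-replica observable. -/
def avg2Bis {n : ℕ} (β : ℝ) (X : Fin n → Fin n → ℝ)
    (f : (Fin n → Bool) → (Fin n → Bool) → ℝ) : ℝ :=
  avg2cBis β X X f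

/-- The SK disorder: i.i.d. entries `N(0, 1/(2n))`. -/
def skMeasure (n : ℕ) : Measure (Fin n → Fin n → ℝ) :=
  Measure.pi fun _ => Measure.pi fun _ => gaussianReal 0 (1 / (2 * n))

/-- The law of the pair `(g, g')` of independent SK disorders. -/
def skPair (n : ℕ) : Measure ((Fin n → Fin n → ℝ) × (Fin n → Fin n → ℝ)) :=
  (skMeasure n).prod (skMeasure n)

/-- The perturbed SK disorder `g_t = √(1-t) g + √t g'`. -/
def skPerturb {n : ℕ} (t : ℝ) (g g' : Fin n → Fin n → ℝ) : Fin n → Fin n → ℝ :=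
  fun i j => Real.sqrt (1 - t) * g i j + Real.sqrt t * g' i j

/-- The sparse disorder: i.i.d. entries `Poisson(d/(2n))`. -/
def sparseMeasure (n : ℕ) (d : ℝ) : Measure (Fin n → Fin n → ℕ) :=
  Measure.pi fun _ => Measure.pi fun _ => poissonMeasure (d / (2 * n)).toNNReal

/-- The law of the triple `(A^{(1-t)}, A^{(t,1)}, A^{(t,2)})` of independent sparse disorders
used to build the coupled pair `A = A^{(1-t)} + A^{(t,1)}`, `A_t = A^{(1-t)} + A^{(t,2)}`. -/
def coupledSparse (n : ℕ) (d t : ℝ) :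
    Measure ((Fin n → Fin n → ℕ) × (Fin n → Fin n → ℕ) × (Fin n → Fin n → ℕ)) :=
  (sparseMeasure n ((1 - t) * d)).prod
    ((sparseMeasure n (t * d)).prod (sparseMeasure n (t * d)))

/-- View an ℕ-valued matrix as a real matrix. -/
def natMat {n : ℕ} (A : Fin n → Fin n → ℕ) : Fin n → Fin n → ℝ := fun i j => (A i j : ℝ)

/-- The Gibbs measure `μ_{β,X}` as a probability measure on configurations. -/
def gibbsMeasure {n : ℕ} (β : ℝ) (X : Fin n → Fin n → ℝ) : Measure (Fin n → Bool) :=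
  ∑ σ : Fin n → Bool, ENNReal.ofReal (gibbs β X σ) • Measure.dirac σ

/-- The bisection Gibbs measure `μ^bis_{β,X}` as a measure on configurations. -/
def gibbsBisMeasure {n : ℕ} (β : ℝ) (X : Fin n → Fin n → ℝ) : Measure (Fin n → Bool) :=
  ∑ σ : Fin n → Bool, ENNReal.ofReal (gibbsBis β X σ) • Measure.dirac σ

/-- Normalized Wasserstein distance `W_{2,n}` between measures on `{-1,1}^n`. -/
def W2 (n : ℕ) (μ1 μ2 : Measure (Fin n → Bool)) : ℝ :=
  sInf {r : ℝ | ∃ π : Measure ((Fin n → Bool) × (Fin n → Bool)),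
    IsProbabilityMeasure π ∧ π.map Prod.fst = μ1 ∧ π.map Prod.snd = μ2 ∧
    r = Real.sqrt (∫ p, (1 / (n : ℝ)) * ∑ i, (spin (p.1 i) - spin (p.2 i)) ^ 2 ∂π)}

open scoped Classical in
/-- Overlap-restricted coupled partition function `Z^S_{X,Y}`. -/
def Zres {n : ℕ} (β : ℝ) (S : Set ℝ) (X Y : Fin n → Fin n → ℝ) : ℝ :=
  ∑ σ1 : Fin n → Bool, ∑ σ2 : Fin n → Bool,
    if overlap σ1 σ2 ∈ S then Real.exp (-β * (Ham X σ1 + Ham Y σ2)) else 0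

open scoped Classical in
/-- Overlap-restricted coupled bisection partition function `Z^{S,bis}_{X,Y}`. -/
def ZresBis {n : ℕ} (β : ℝ) (S : Set ℝ) (X Y : Fin n → Fin n → ℝ) : ℝ :=
  ∑ σ1 : Fin n → Bool, ∑ σ2 : Fin n → Bool,
    if isBis σ1 ∧ isBis σ2 ∧ overlap σ1 σ2 ∈ S
    then Real.exp (-β * (Ham X σ1 + Ham Y σ2)) else 0

/-- The matrix with a single `1` in position `(i,j)`. -/
def Jmat {n : ℕ} (i j : Fin n) : Fin n → Fin n → ℝ :=
  fun a b => if a = i ∧ b = j then 1 else 0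

end

set_option linter.unusedSectionVars false

section GaussianRotation

variable {E : Type*} [NormedAddCommGroup E] [NormedSpace ℝ E] [MeasurableSpace E] [BorelSpace E]
  [SecondCountableTopology E] {μ : Measure E}

/-- Integrals over two independent copies are unchanged by a rotation of the pair. -/
lemma integral_comp_rotation
    (hrot : ∀ θ, (μ.prod μ).map (ContinuousLinearMap.rotation θ) = μ.prod μ)
    (θ : ℝ) {f : E × E → ℝ} (hf : StronglyMeasurable f) :
    ∫ p, f (ContinuousLinearMap.rotation θ p) ∂(μ.prod μ) = ∫ p, f p ∂(μ.prod μ) := by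
  conv_rhs => rw [← hrot θ]
  rw [integral_map (by fun_prop) hf.aestronglyMeasurable]

lemma norm_cos_smul_add_sin_smul_le (θ : ℝ) (x y : E) :
    ‖Real.cos θ • x + Real.sin θ • y‖ ≤ ‖x‖ + ‖y‖ := by
  refine (norm_add_le _ _).trans ?_
  rw [norm_smul, norm_smul]
  gcongr
  · exact mul_le_of_le_one_left (norm_nonneg _) (Real.abs_cos_le_one θ)
  · exact mul_le_of_le_one_left (norm_nonneg _) (Real.abs_sin_le_one θ)

lemma norm_neg_sin_smul_add_cos_smul_le (θ : ℝ) (x y : E) :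
    ‖-Real.sin θ • x + Real.cos θ • y‖ ≤ ‖x‖ + ‖y‖ := by
  refine (norm_add_le _ _).trans ?_
  rw [norm_smul, norm_smul, norm_neg]
  gcongr
  · exact mul_le_of_le_one_left (norm_nonneg _) (Real.abs_sin_le_one θ)
  · exact mul_le_of_le_one_left (norm_nonneg _) (Real.abs_cos_le_one θ)

lemma hasDerivAt_cos_smul_add_sin_smul (θ : ℝ) (x y : E) :
    HasDerivAt (fun θ : ℝ => Real.cos θ • x + Real.sin θ • y)
      (-Real.sin θ • x + Real.cos θ • y) θ :=
  ((Real.hasDerivAt_cos θ).smul_const x).add ((Real.hasDerivAt_sin θ).smul_const y)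

lemma hasDerivAt_neg_sin_smul_add_cos_smul (θ : ℝ) (x y : E) :
    HasDerivAt (fun θ : ℝ => -Real.sin θ • x + Real.cos θ • y)
      (-(Real.cos θ • x + Real.sin θ • y)) θ := by
  have h := ((Real.hasDerivAt_sin θ).neg.smul_const x).add ((Real.hasDerivAt_cos θ).smul_const y)
  have he : -Real.cos θ • x + -Real.sin θ • y = -(Real.cos θ • x + Real.sin θ • y) := by module
  rwa [he] at h

lemma integrable_sq_norm_add_norm [IsProbabilityMeasure μ]
    (hμ : MemLp (id : E → E) 2 μ) :
    Integrable (fun p : E × E => (‖p.1‖ + ‖p.2‖) ^ 2) (μ.prod μ) := by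
  have h1 : MemLp (fun p : E × E => ‖p.1‖) 2 (μ.prod μ) :=
    (hμ.comp_measurePreserving measurePreserving_fst).norm
  have h2 : MemLp (fun p : E × E => ‖p.2‖) 2 (μ.prod μ) :=
    (hμ.comp_measurePreserving measurePreserving_snd).norm
  exact (h1.add h2).integrable_sq

lemma integrable_norm_add_norm [IsProbabilityMeasure μ]
    (hμ : MemLp (id : E → E) 2 μ) :
    Integrable (fun p : E × E => ‖p.1‖ + ‖p.2‖) (μ.prod μ) := by
  have h1 : MemLp (fun p : E × E => ‖p.1‖) 2 (μ.prod μ) :=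
    (hμ.comp_measurePreserving measurePreserving_fst).norm
  have h2 : MemLp (fun p : E × E => ‖p.2‖) 2 (μ.prod μ) :=
    (hμ.comp_measurePreserving measurePreserving_snd).norm
  exact (h1.add h2).integrable (by norm_num)

/-- Gaussian integration by parts, deduced from rotation invariance. -/
lemma integral_mul_dual_eq_integral_fderiv [IsProbabilityMeasure μ]
    (hrot : ∀ θ, (μ.prod μ).map (ContinuousLinearMap.rotation θ) = μ.prod μ)
    (hμ : MemLp (id : E → E) 2 μ) {f : E → ℝ} {f' : E → E →L[ℝ] ℝ} {C : ℝ}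
    (hf : ∀ x, HasFDerivAt f (f' x) x) (hf' : Continuous f')
    (hC : ∀ x, |f x| ≤ C) (hC' : ∀ x, ‖f' x‖ ≤ C) (L : E →L[ℝ] ℝ) :
    ∫ x, f x * L x ∂μ = ∫ p, f' p.1 p.2 * L p.2 ∂(μ.prod μ) := by
  have hfc : Continuous f := continuous_iff_continuousAt.2 fun x => (hf x).continuousAt
  have hC0 : 0 ≤ C := (abs_nonneg _).trans (hC 0)
  set F : ℝ → E × E → ℝ := fun θ p =>
    f (Real.cos θ • p.1 + Real.sin θ • p.2) * L (-Real.sin θ • p.1 + Real.cos θ • p.2) with hF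
  set F' : ℝ → E × E → ℝ := fun θ p =>
    f' (Real.cos θ • p.1 + Real.sin θ • p.2) (-Real.sin θ • p.1 + Real.cos θ • p.2) *
        L (-Real.sin θ • p.1 + Real.cos θ • p.2) +
      f (Real.cos θ • p.1 + Real.sin θ • p.2) *
        L (-(Real.cos θ • p.1 + Real.sin θ • p.2)) with hF'
  have hint1 := integrable_norm_add_norm hμ
  have hint2 := integrable_sq_norm_add_norm hμ
  have hFint : ∀ θ, Integrable (F θ) (μ.prod μ) := by
    intro θ
    refine (hint1.const_mul (C * ‖L‖)).mono'
      (by simp only [hF]; exact Continuous.aestronglyMeasurable (by fun_prop))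
      (ae_of_all _ fun p => ?_)
    simp only [hF, norm_mul, mul_assoc]
    refine mul_le_mul (hC _) ((L.le_opNorm _).trans ?_) (norm_nonneg _) hC0
    gcongr
    exact norm_neg_sin_smul_add_cos_smul_le θ p.1 p.2
  have hd := hasDerivAt_integral_of_dominated_loc_of_deriv_le (μ := μ.prod μ) (F := F) (F' := F')
    (x₀ := (0 : ℝ)) (s := Set.univ)
    (bound := fun p => C * ‖L‖ * (‖p.1‖ + ‖p.2‖) ^ 2 + C * ‖L‖ * (‖p.1‖ + ‖p.2‖))
    univ_mem (Eventually.of_forall fun θ => (hFint θ).aestronglyMeasurable) (hFint 0)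
    (by simp only [hF']; exact Continuous.aestronglyMeasurable (by fun_prop))
    (ae_of_all _ fun p θ _ => by
      have h1 := norm_cos_smul_add_sin_smul_le θ p.1 p.2
      have h2 := norm_neg_sin_smul_add_cos_smul_le θ p.1 p.2
      simp only [hF']
      refine (norm_add_le _ _).trans (add_le_add ?_ ?_)
      · rw [norm_mul]
        calc _ ≤ (C * (‖p.1‖ + ‖p.2‖)) * (‖L‖ * (‖p.1‖ + ‖p.2‖)) := by
              refine mul_le_mul ?_ ?_ (norm_nonneg _) (by positivity)
              · exact ((f' _).le_opNorm _).trans (mul_le_mul (hC' _) h2 (norm_nonneg _) hC0)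
              · exact (L.le_opNorm _).trans (by gcongr)
          _ = _ := by ring
      · rw [norm_mul, mul_assoc]
        refine mul_le_mul (hC _) ((L.le_opNorm _).trans ?_) (norm_nonneg _) hC0
        rw [norm_neg]
        gcongr)
    ((hint2.const_mul _).add (hint1.const_mul _))
    (ae_of_all _ fun p θ _ => by
      simp only [hF, hF']
      exact ((hf _).comp_hasDerivAt θ (hasDerivAt_cos_smul_add_sin_smul θ p.1 p.2)).mul
        (L.hasFDerivAt.comp_hasDerivAt θ (hasDerivAt_neg_sin_smul_add_cos_smul θ p.1 p.2)))
  have hconst : (fun θ => ∫ p, F θ p ∂(μ.prod μ)) = fun _ => ∫ p, f p.1 * L p.2 ∂(μ.prod μ) := by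
    funext θ
    exact integral_comp_rotation hrot θ (f := fun p => f p.1 * L p.2)
      (Continuous.stronglyMeasurable (by fun_prop))
  have hzero : ∫ p, F' 0 p ∂(μ.prod μ) = 0 := by
    have h := hd.2
    rw [hconst] at h
    exact h.unique (hasDerivAt_const _ _)
  have hfL : Integrable (fun x => f x * L x) μ := by
    refine ((hμ.integrable (by norm_num)).norm.const_mul (C * ‖L‖)).mono'
      (Continuous.aestronglyMeasurable (by fun_prop)) (ae_of_all _ fun x => ?_)
    rw [norm_mul, mul_assoc]
    exact mul_le_mul (hC _) (L.le_opNorm _) (norm_nonneg _) hC0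
  have hfL2 : Integrable (fun p : E × E => f p.1 * L p.1) (μ.prod μ) :=
    measurePreserving_fst.integrable_comp_of_integrable hfL
  have heq : ∀ p : E × E, f' p.1 p.2 * L p.2 = F' 0 p + f p.1 * L p.1 := by
    intro p
    simp [hF']
  simp_rw [heq]
  rw [integral_add hd.1 hfL2, hzero, zero_add, integral_fun_fst (fun x => f x * L x)]
  simp

/-- Derivative in the angle of the correlation of `A` and `B` evaluated at two correlated copies of
a Gaussian vector. -/
lemma hasDerivAt_integral_mul_rotation [IsProbabilityMeasure μ]
    (hrot : ∀ θ, (μ.prod μ).map (ContinuousLinearMap.rotation θ) = μ.prod μ)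
    (hμ : MemLp (id : E → E) 2 μ) {A B : E → ℝ} {A' B' : E → E →L[ℝ] ℝ} {C : ℝ}
    (hA : ∀ x, HasFDerivAt A (A' x) x) (hA' : Continuous A')
    (hB : ∀ x, HasFDerivAt B (B' x) x) (hB' : Continuous B')
    (hAC : ∀ x, |A x| ≤ C) (hAC' : ∀ x, ‖A' x‖ ≤ C)
    (hBC : ∀ x, |B x| ≤ C) (hBC' : ∀ x, ‖B' x‖ ≤ C) (θ : ℝ) :
    HasDerivAt (fun θ => ∫ p, A p.1 * B (Real.cos θ • p.1 + Real.sin θ • p.2) ∂(μ.prod μ))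
      (-Real.sin θ * ∫ p, (∫ w, A' p.1 w * B' (Real.cos θ • p.1 + Real.sin θ • p.2) w ∂μ)
        ∂(μ.prod μ)) θ := by
  have hAc : Continuous A := continuous_iff_continuousAt.2 fun x => (hA x).continuousAt
  have hBc : Continuous B := continuous_iff_continuousAt.2 fun x => (hB x).continuousAt
  have hC0 : 0 ≤ C := (abs_nonneg _).trans (hAC 0)
  have hint1 := integrable_norm_add_norm hμ
  set F' : ℝ → E × E → ℝ := fun θ p => A p.1 *
    B' (Real.cos θ • p.1 + Real.sin θ • p.2) (-Real.sin θ • p.1 + Real.cos θ • p.2) with hF'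
  have hd := hasDerivAt_integral_of_dominated_loc_of_deriv_le (μ := μ.prod μ)
    (F := fun θ p => A p.1 * B (Real.cos θ • p.1 + Real.sin θ • p.2)) (F' := F')
    (x₀ := θ) (s := Set.univ)
    (bound := fun p => C * C * (‖p.1‖ + ‖p.2‖))
    univ_mem (Eventually.of_forall fun θ => Continuous.aestronglyMeasurable (by fun_prop))
    ((integrable_const (C * C)).mono' (Continuous.aestronglyMeasurable (by fun_prop))
      (ae_of_all _ fun p => by
        rw [norm_mul]; exact mul_le_mul (hAC _) (hBC _) (norm_nonneg _) hC0))
    (by simp only [hF']; exact Continuous.aestronglyMeasurable (by fun_prop))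
    (ae_of_all _ fun p θ _ => by
      have h2 := norm_neg_sin_smul_add_cos_smul_le θ p.1 p.2
      simp only [hF', norm_mul, mul_assoc]
      exact mul_le_mul (hAC _) (((B' _).le_opNorm _).trans
        (mul_le_mul (hBC' _) h2 (norm_nonneg _) hC0)) (norm_nonneg _) hC0)
    (hint1.const_mul _)
    (ae_of_all _ fun p θ _ =>
      ((hB _).comp_hasDerivAt θ (hasDerivAt_cos_smul_add_sin_smul θ p.1 p.2)).const_mul _)
  have hinv : ∀ x y : E, Real.cos θ • (Real.cos θ • x + Real.sin θ • y) -
      Real.sin θ • (-Real.sin θ • x + Real.cos θ • y) = x := by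
    intro x y
    have h := Real.cos_sq_add_sin_sq θ
    have : Real.cos θ • (Real.cos θ • x + Real.sin θ • y) -
      Real.sin θ • (-Real.sin θ • x + Real.cos θ • y) =
        (Real.cos θ ^ 2 + Real.sin θ ^ 2) • x := by module
    rw [this, h, one_smul]
  have hr1 : ∫ p, F' θ p ∂(μ.prod μ) =
      ∫ p, A (Real.cos θ • p.1 - Real.sin θ • p.2) * B' p.1 p.2 ∂(μ.prod μ) := by
    rw [← integral_comp_rotation hrot θ
      (f := fun p => A (Real.cos θ • p.1 - Real.sin θ • p.2) * B' p.1 p.2)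
      (Continuous.stronglyMeasurable (by fun_prop))]
    refine integral_congr_ae (ae_of_all _ fun p => ?_)
    simp only [hF', ContinuousLinearMap.rotation_apply, hinv]
  have hr2 : ∫ p, (∫ w, A' (Real.cos θ • p.1 - Real.sin θ • p.2) w * B' p.1 w ∂μ) ∂(μ.prod μ) =
      ∫ p, (∫ w, A' p.1 w * B' (Real.cos θ • p.1 + Real.sin θ • p.2) w ∂μ) ∂(μ.prod μ) := by
    rw [← integral_comp_rotation hrot θ
      (f := fun p => ∫ w, A' (Real.cos θ • p.1 - Real.sin θ • p.2) w * B' p.1 w ∂μ)]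
    · refine integral_congr_ae (ae_of_all _ fun p => ?_)
      simp only [ContinuousLinearMap.rotation_apply, hinv]
    · refine StronglyMeasurable.integral_prod_right (f := fun (p : E × E) w =>
        A' (Real.cos θ • p.1 - Real.sin θ • p.2) w * B' p.1 w) ?_
      exact Continuous.stronglyMeasurable (by fun_prop)
  have hsq : Integrable (fun x : E => ‖x‖ ^ 2) μ := hμ.norm.integrable_sq
  have hi1 : Integrable (fun p : E × E => A (Real.cos θ • p.1 - Real.sin θ • p.2) * B' p.1 p.2)
      (μ.prod μ) := by
    refine (hint1.const_mul (C * C)).mono' (Continuous.aestronglyMeasurable (by fun_prop))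
      (ae_of_all _ fun p => ?_)
    rw [norm_mul, mul_assoc]
    refine mul_le_mul (hAC _) (((B' _).le_opNorm _).trans ?_) (norm_nonneg _) hC0
    exact mul_le_mul (hBC' _) (le_add_of_nonneg_left (norm_nonneg _)) (norm_nonneg _) hC0
  have hi3 : Integrable (fun q : (E × E) × E =>
      A' (Real.cos θ • q.1.1 - Real.sin θ • q.1.2) q.2 * B' q.1.1 q.2) ((μ.prod μ).prod μ) := by
    have hs : Integrable (fun q : (E × E) × E => ‖q.2‖ ^ 2) ((μ.prod μ).prod μ) :=
      measurePreserving_snd.integrable_comp_of_integrable hsq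
    refine (hs.const_mul (C * C)).mono' (Continuous.aestronglyMeasurable (by fun_prop))
      (ae_of_all _ fun q => ?_)
    rw [norm_mul]
    calc _ ≤ (C * ‖q.2‖) * (C * ‖q.2‖) := by
          refine mul_le_mul (((A' _).le_opNorm _).trans ?_) (((B' _).le_opNorm _).trans ?_)
            (norm_nonneg _) (by positivity)
          · exact mul_le_mul_of_nonneg_right (hAC' _) (norm_nonneg _)
          · exact mul_le_mul_of_nonneg_right (hBC' _) (norm_nonneg _)
      _ = _ := by ring
  have hibp : ∀ z : E, ∫ w, A (Real.cos θ • z - Real.sin θ • w) * B' z w ∂μ =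
      -Real.sin θ *
        ∫ w, (∫ w', A' (Real.cos θ • z - Real.sin θ • w) w' * B' z w' ∂μ) ∂μ := by
    intro z
    have hi2 : Integrable (fun q : E × E =>
        A' (Real.cos θ • z - Real.sin θ • q.1) q.2 * B' z q.2) (μ.prod μ) := by
      have hs : Integrable (fun q : E × E => ‖q.2‖ ^ 2) (μ.prod μ) :=
        measurePreserving_snd.integrable_comp_of_integrable hsq
      refine (hs.const_mul (C * C)).mono' (Continuous.aestronglyMeasurable (by fun_prop))
        (ae_of_all _ fun q => ?_)
      rw [norm_mul]
      calc _ ≤ (C * ‖q.2‖) * (C * ‖q.2‖) := by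
            refine mul_le_mul (((A' _).le_opNorm _).trans ?_) (((B' _).le_opNorm _).trans ?_)
              (norm_nonneg _) (by positivity)
            · exact mul_le_mul_of_nonneg_right (hAC' _) (norm_nonneg _)
            · exact mul_le_mul_of_nonneg_right (hBC' _) (norm_nonneg _)
        _ = _ := by ring
    rw [integral_mul_dual_eq_integral_fderiv hrot hμ (C := C)
      (f := fun w => A (Real.cos θ • z - Real.sin θ • w))
      (f' := fun w => -Real.sin θ • A' (Real.cos θ • z - Real.sin θ • w)) ?_ (by fun_prop)
      (fun x => hAC _) ?_ (B' z)]
    · rw [← integral_prod _ hi2, ← integral_const_mul]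
      refine integral_congr_ae (ae_of_all _ fun p => ?_)
      simp [mul_assoc]
    · intro w
      have h1 : HasFDerivAt (fun w : E => Real.cos θ • z - Real.sin θ • w)
          (-(Real.sin θ • ContinuousLinearMap.id ℝ E)) w :=
        ((hasFDerivAt_id w).const_smul (Real.sin θ)).const_sub _
      refine ((hA _).comp w h1).congr_fderiv ?_
      ext v
      simp
    · intro w
      rw [norm_smul, norm_neg]
      exact (mul_le_of_le_one_left (norm_nonneg _) (Real.abs_sin_le_one θ)).trans (hAC' _)
  have key : ∫ p, F' θ p ∂(μ.prod μ) = -Real.sin θ *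
      ∫ p, (∫ w, A' p.1 w * B' (Real.cos θ • p.1 + Real.sin θ • p.2) w ∂μ) ∂(μ.prod μ) := by
    rw [hr1, ← hr2, integral_prod _ hi1, integral_prod _ hi3.integral_prod_left]
    simp_rw [hibp]
    rw [integral_const_mul]
  rw [← key]
  exact hd.2

end GaussianRotation

section NoiseCorrelation

variable {E : Type*} [NormedAddCommGroup E] [NormedSpace ℝ E] [MeasurableSpace E] [BorelSpace E]
  [SecondCountableTopology E] {μ : Measure E}

/-- A bounded continuous function is integrable for a probability measure. -/
lemma integrable_of_continuous_of_abs_le {X : Type*} [TopologicalSpace X] [MeasurableSpace X]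
    [OpensMeasurableSpace X] [SecondCountableTopology X] {ν : Measure X} [IsProbabilityMeasure ν]
    {f : X → ℝ} (hf : Continuous f) {C : ℝ} (hC : ∀ x, |f x| ≤ C) : Integrable f ν :=
  (integrable_const C).mono' hf.aestronglyMeasurable (ae_of_all _ hC)

/-- The average of `F` over the noise has second moment equal to the self-correlation of `F` at the
squared correlation parameter. -/
lemma integral_sq_integral_noise [IsProbabilityMeasure μ]
    (hrot : ∀ θ, (μ.prod μ).map (ContinuousLinearMap.rotation θ) = μ.prod μ)
    {F : E → ℝ} (hF : Continuous F) (hF1 : ∀ x, |F x| ≤ 1) {s : ℝ} (hs0 : 0 ≤ s) (hs1 : s ≤ 1) :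
    ∫ x, (∫ y, F (s • x + √(1 - s ^ 2) • y) ∂μ) ^ 2 ∂μ =
      ∫ p, F p.1 * F (s ^ 2 • p.1 + √(1 - (s ^ 2) ^ 2) • p.2) ∂(μ.prod μ) := by
  set r := √(1 - s ^ 2) with hr
  have hr2 : r ^ 2 = 1 - s ^ 2 := Real.sq_sqrt (by nlinarith)
  have hcos : Real.cos (Real.arccos s) = s := Real.cos_arccos (by linarith) hs1
  have hsin : Real.sin (Real.arccos s) = r := Real.sin_arccos s
  set P : E → ℝ := fun x => ∫ y, F (s • x + r • y) ∂μ with hP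
  have hPm : StronglyMeasurable P :=
    StronglyMeasurable.integral_prod_right (f := fun x y => F (s • x + r • y))
      (Continuous.stronglyMeasurable (by fun_prop))
  have hFF : ∀ x y, |F x * F y| ≤ 1 := fun x y => by
    rw [abs_mul]; exact mul_le_one₀ (hF1 _) (abs_nonneg _) (hF1 _)
  have hP1 : ∀ x, |P x| ≤ 1 := fun x => by
    have := norm_integral_le_of_norm_le_const (μ := μ) (f := fun y => F (s • x + r • y)) (C := 1)
      (ae_of_all _ fun y => hF1 _)
    simpa using this
  have hFP : ∀ x y, |F x * P y| ≤ 1 := fun x y => by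
    rw [abs_mul]; exact mul_le_one₀ (hF1 _) (abs_nonneg _) (hP1 _)
  have h1 : ∫ x, P x ^ 2 ∂μ = ∫ p, F (s • p.1 + r • p.2) * P p.1 ∂(μ.prod μ) := by
    rw [integral_prod]
    · refine integral_congr_ae (ae_of_all _ fun x => ?_)
      simp only [hP]
      rw [integral_mul_const, sq]
    · refine (integrable_const (1 : ℝ)).mono' (AEStronglyMeasurable.mul
        (Continuous.aestronglyMeasurable (by fun_prop))
        (hPm.comp_measurable measurable_fst).aestronglyMeasurable) (ae_of_all _ fun p => hFP _ _)
  have hinv : ∀ x y : E, s • (s • x + r • y) - r • (-r • x + s • y) = x := by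
    intro x y
    have : s • (s • x + r • y) - r • (-r • x + s • y) = (s ^ 2 + r ^ 2) • x := by module
    rw [this, hr2, add_sub_cancel, one_smul]
  have h2 : ∫ p, F (s • p.1 + r • p.2) * P p.1 ∂(μ.prod μ) =
      ∫ p, F p.1 * P (s • p.1 - r • p.2) ∂(μ.prod μ) := by
    rw [← integral_comp_rotation hrot (Real.arccos s)
      (f := fun p => F p.1 * P (s • p.1 - r • p.2))]
    · refine integral_congr_ae (ae_of_all _ fun p => ?_)
      simp only [ContinuousLinearMap.rotation_apply, hcos, hsin, hinv]
    · exact (hF.comp continuous_fst).stronglyMeasurable.mul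
        (hPm.comp_measurable (Continuous.measurable (by fun_prop)))
  have h3 : ∀ u : E, ∫ w, P (s • u - r • w) ∂μ =
      ∫ y, F (s ^ 2 • u + √(1 - (s ^ 2) ^ 2) • y) ∂μ := by
    intro u
    have hρ : √(1 - (s ^ 2) ^ 2) = r * √(1 + s ^ 2) := by
      rw [hr, ← Real.sqrt_mul (by nlinarith)]
      congr 1
      ring
    have hpos : √(1 + s ^ 2) ≠ 0 := by positivity
    have e1 : ∫ w, P (s • u - r • w) ∂μ =
        ∫ p, F (s • (s • u - r • p.1) + r • p.2) ∂(μ.prod μ) := by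
      rw [integral_prod]
      exact integrable_of_continuous_of_abs_le (by fun_prop) fun p => hF1 _
    have e2 : ∫ p, F (s ^ 2 • u + √(1 - (s ^ 2) ^ 2) • p.2) ∂(μ.prod μ) =
        ∫ y, F (s ^ 2 • u + √(1 - (s ^ 2) ^ 2) • y) ∂μ := by
      rw [integral_fun_snd (fun y => F (s ^ 2 • u + √(1 - (s ^ 2) ^ 2) • y))]
      simp
    rw [e1, ← e2, ← integral_comp_rotation hrot (Real.arctan s)
      (f := fun p => F (s ^ 2 • u + √(1 - (s ^ 2) ^ 2) • p.2))
      (Continuous.stronglyMeasurable (by fun_prop))]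
    refine integral_congr_ae (ae_of_all _ fun p => ?_)
    simp only [ContinuousLinearMap.rotation_apply, Real.cos_arctan, Real.sin_arctan, hρ]
    congr 1
    have e3 : r * √(1 + s ^ 2) * (s / √(1 + s ^ 2)) = r * s := by field_simp
    have e4 : r * √(1 + s ^ 2) * (1 / √(1 + s ^ 2)) = r := by field_simp
    rw [smul_add, smul_smul, smul_smul, mul_neg, e3, e4]
    module
  rw [h1, h2, integral_prod, integral_prod]
  · simp_rw [integral_const_mul, h3]
  · exact integrable_of_continuous_of_abs_le (by fun_prop) fun p => hFF _ _
  · exact (integrable_const (1 : ℝ)).mono' (AEStronglyMeasurable.mul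
      (Continuous.aestronglyMeasurable (by fun_prop))
      (hPm.comp_measurable (Continuous.measurable (by fun_prop))).aestronglyMeasurable)
      (ae_of_all _ fun p => hFP _ _)

/-- Log-convexity of the noise correlation along the doubling of the noise level. -/
lemma sq_sum_noise_correlation_le [IsProbabilityMeasure μ]
    (hrot : ∀ θ, (μ.prod μ).map (ContinuousLinearMap.rotation θ) = μ.prod μ)
    {ι : Type*} [Fintype ι] {F : ι → E → ℝ} (hF : ∀ i, Continuous (F i))
    (hF1 : ∀ i x, |F i x| ≤ 1) {s : ℝ} (hs0 : 0 ≤ s) (hs1 : s ≤ 1) :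
    (∑ i, ∫ p, F i p.1 * F i (s • p.1 + √(1 - s ^ 2) • p.2) ∂(μ.prod μ)) ^ 2 ≤
      Fintype.card ι *
        ∑ i, ∫ p, F i p.1 * F i (s ^ 2 • p.1 + √(1 - (s ^ 2) ^ 2) • p.2) ∂(μ.prod μ) := by
  simp_rw [← integral_sq_integral_noise hrot (hF _) (hF1 _) hs0 hs1]
  set P : ι → E → ℝ := fun i x => ∫ y, F i (s • x + √(1 - s ^ 2) • y) ∂μ with hP
  have hPm : ∀ i, StronglyMeasurable (P i) := fun i =>
    StronglyMeasurable.integral_prod_right (f := fun x y => F i (s • x + √(1 - s ^ 2) • y))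
      (Continuous.stronglyMeasurable (by have := hF i; fun_prop))
  have hP1 : ∀ i x, |P i x| ≤ 1 := fun i x => by
    have := norm_integral_le_of_norm_le_const (μ := μ)
      (f := fun y => F i (s • x + √(1 - s ^ 2) • y)) (C := 1) (ae_of_all _ fun y => hF1 _ _)
    simpa using this
  have hN : ∀ i, ∫ p, F i p.1 * F i (s • p.1 + √(1 - s ^ 2) • p.2) ∂(μ.prod μ) =
      ∫ x, F i x * P i x ∂μ := fun i => by
    rw [integral_prod]
    · simp_rw [integral_const_mul]; rfl
    · have := hF i
      refine integrable_of_continuous_of_abs_le (C := 1) (by fun_prop) fun p => ?_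
      rw [abs_mul]; exact mul_le_one₀ (hF1 _ _) (abs_nonneg _) (hF1 _ _)
  simp_rw [hN]
  have hFi : ∀ i, Integrable (fun x => F i x * P i x) μ := fun i =>
    (integrable_const (1 : ℝ)).mono'
      ((hF i).aestronglyMeasurable.mul (hPm i).aestronglyMeasurable) (ae_of_all _ fun x => by
        rw [norm_mul]; exact mul_le_one₀ (hF1 _ _) (abs_nonneg _) (hP1 _ _))
  have hPi : ∀ i, Integrable (fun x => P i x ^ 2) μ := fun i =>
    (integrable_const (1 : ℝ)).mono' ((hPm i).pow 2).aestronglyMeasurable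
      (ae_of_all _ fun x => by
        rw [norm_pow]; exact pow_le_one₀ (norm_nonneg _) (hP1 _ _))
  have hquad : ∀ a : ℝ, 2 * a * ∑ i, ∫ x, F i x * P i x ∂μ ≤
      a ^ 2 * Fintype.card ι + ∑ i, ∫ x, P i x ^ 2 ∂μ := by
    intro a
    have hi : ∀ i, 2 * a * ∫ x, F i x * P i x ∂μ ≤ a ^ 2 + ∫ x, P i x ^ 2 ∂μ := by
      intro i
      have e : a ^ 2 + ∫ x, P i x ^ 2 ∂μ = ∫ x, (a ^ 2 + P i x ^ 2) ∂μ := by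
        rw [integral_add (integrable_const _) (hPi i)]; simp
      rw [e, ← integral_const_mul]
      refine integral_mono ((hFi i).const_mul _) ((integrable_const _).add (hPi i)) fun x => ?_
      have hsq : F i x ^ 2 ≤ 1 := by
        rw [← sq_abs]; exact pow_le_one₀ (abs_nonneg _) (hF1 i x)
      simp only
      nlinarith [sq_nonneg (a * F i x - P i x), mul_le_mul_of_nonneg_left hsq (sq_nonneg a)]
    calc 2 * a * ∑ i, ∫ x, F i x * P i x ∂μ = ∑ i, 2 * a * ∫ x, F i x * P i x ∂μ := by
          rw [Finset.mul_sum]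
      _ ≤ ∑ i, (a ^ 2 + ∫ x, P i x ^ 2 ∂μ) := Finset.sum_le_sum fun i _ => hi i
      _ = _ := by rw [Finset.sum_add_distrib]; simp [mul_comm]
  rcases isEmpty_or_nonempty ι with hι | hι
  · simp
  have hm : (0 : ℝ) < Fintype.card ι := by exact_mod_cast Fintype.card_pos
  set N := ∑ i, ∫ x, F i x * P i x ∂μ
  set Q := ∑ i, ∫ x, P i x ^ 2 ∂μ
  have h := hquad (N / Fintype.card ι)
  have h' := mul_le_mul_of_nonneg_left h hm.le
  have e1 : (Fintype.card ι : ℝ) * (2 * (N / Fintype.card ι) * N) = 2 * N ^ 2 := by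
    field_simp
  have e2 : (Fintype.card ι : ℝ) * ((N / Fintype.card ι) ^ 2 * Fintype.card ι + Q) =
      N ^ 2 + Fintype.card ι * Q := by
    field_simp
  rw [e1, e2] at h'
  linarith

end NoiseCorrelation

section SKDisorder

variable {n : ℕ}

lemma spin_mul_self (b : Bool) : spin b * spin b = 1 := by cases b <;> simp [spin]

lemma spin_eq_one_or (b : Bool) : spin b = 1 ∨ spin b = -1 := by cases b <;> simp [spin]

lemma abs_spin (b : Bool) : |spin b| = 1 := by cases b <;> simp [spin]

lemma isGaussian_pi {ι : Type*} [Fintype ι] {F : Type*} [NormedAddCommGroup F] [NormedSpace ℝ F]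
    [MeasurableSpace F] [BorelSpace F] [SecondCountableTopology F] [CompleteSpace F]
    (μ : ι → Measure F) [∀ i, IsGaussian (μ i)] : IsGaussian (Measure.pi μ) := by
  have hind : iIndepFun (fun i (ω : ι → F) => ω i) (Measure.pi μ) :=
    iIndepFun_pi (X := fun _ x => x) fun _ => aemeasurable_id
  have h : ∀ i, HasGaussianLaw (fun ω : ι → F => ω i) (Measure.pi μ) := fun i =>
    ⟨by
      rw [(measurePreserving_eval μ i).map_eq]
      infer_instance⟩
  have := (iIndepFun.hasGaussianLaw h hind).isGaussian_map
  simpa using this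

instance isGaussian_skMeasure (n : ℕ) : IsGaussian (skMeasure n) := by
  have : IsGaussian (Measure.pi fun _ : Fin n => gaussianReal 0 (1 / (2 * n) : NNReal)) :=
    isGaussian_pi _
  exact isGaussian_pi _

/-- Flipping the signs of the entries preserves the law of the disorder. -/
lemma measurePreserving_sign_mul (a : Fin n → Fin n → ℝ) (ha : ∀ i j, a i j = 1 ∨ a i j = -1) :
    MeasurePreserving (fun y : Fin n → Fin n → ℝ => fun i j => a i j * y i j)
      (skMeasure n) (skMeasure n) := by
  refine measurePreserving_pi (f := fun i (y : Fin n → ℝ) => fun j => a i j * y j) _ _ fun i => ?_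
  refine measurePreserving_pi (f := fun j (y : ℝ) => a i j * y) _ _ fun j => ⟨by fun_prop, ?_⟩
  rw [gaussianReal_map_const_mul]
  rcases ha i j with h | h <;> simp [h]

lemma integral_sign_mul (a : Fin n → Fin n → ℝ) (ha : ∀ i j, a i j = 1 ∨ a i j = -1)
    {F : Type*} [NormedAddCommGroup F] [NormedSpace ℝ F] {f : (Fin n → Fin n → ℝ) → F}
    (hf : StronglyMeasurable f) :
    ∫ y, f (fun i j => a i j * y i j) ∂(skMeasure n) = ∫ y, f y ∂(skMeasure n) := by
  have h := measurePreserving_sign_mul a ha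
  conv_rhs => rw [← h.map_eq]
  rw [integral_map h.aemeasurable hf.aestronglyMeasurable]

lemma integral_id_skMeasure : ∫ y, id y ∂(skMeasure n) = 0 := by
  have h := integral_sign_mul (n := n) (fun _ _ => -1) (fun _ _ => Or.inr rfl)
    (f := id) stronglyMeasurable_id
  have h2 : (fun y : Fin n → Fin n → ℝ => id (fun i j => -1 * y i j)) = fun y => -id y := by
    ext; simp
  rw [h2, integral_neg] at h
  exact self_eq_neg.mp h.symm

lemma map_rotation_skMeasure (θ : ℝ) :
    ((skMeasure n).prod (skMeasure n)).map (ContinuousLinearMap.rotation θ) =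
      (skMeasure n).prod (skMeasure n) :=
  IsGaussian.map_rotation_eq_self integral_id_skMeasure θ

lemma memLp_id_skMeasure : MemLp (id : (Fin n → Fin n → ℝ) → _) 2 (skMeasure n) :=
  IsGaussian.memLp_two_id

lemma measurable_apply_apply (i j : Fin n) : Measurable fun w : Fin n → Fin n → ℝ => w i j :=
  (measurable_pi_apply j).comp (measurable_pi_apply i)

lemma memLp_apply_skMeasure (i j : Fin n) :
    MemLp (fun w : Fin n → Fin n → ℝ => w i j) 2 (skMeasure n) := by
  refine (memLp_id_skMeasure (n := n)).mono
    (measurable_apply_apply i j).aestronglyMeasurable (ae_of_all _ fun w => ?_)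
  exact (norm_le_pi_norm (w i) j).trans (norm_le_pi_norm w i)

lemma map_apply_skMeasure (i j : Fin n) :
    (skMeasure n).map (fun w => w i j) = gaussianReal 0 (1 / (2 * n)) := by
  have h1 := measurePreserving_eval
    (fun _ : Fin n => Measure.pi fun _ : Fin n => gaussianReal 0 (1 / (2 * n) : NNReal)) i
  have h2 := measurePreserving_eval
    (fun _ : Fin n => gaussianReal 0 (1 / (2 * n) : NNReal)) j
  exact (h2.comp h1).map_eq

lemma integral_apply_mul_apply (i j k l : Fin n) :
    ∫ w, w i j * w k l ∂(skMeasure n) = if i = k ∧ j = l then 1 / (2 * (n : ℝ)) else 0 := by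
  split_ifs with h
  · obtain ⟨rfl, rfl⟩ := h
    have h1 : ∫ w, w i j * w i j ∂(skMeasure n) =
        ∫ x, x ^ 2 ∂((skMeasure n).map (fun w => w i j)) := by
      rw [integral_map (measurable_apply_apply i j).aemeasurable (by fun_prop)]
      simp [sq]
    have h2 : ∫ x, x ^ 2 ∂(gaussianReal 0 (1 / (2 * n) : NNReal)) = 1 / (2 * (n : ℝ)) := by
      have := variance_fun_id_gaussianReal (μ := 0) (v := (1 / (2 * n) : NNReal))
      rw [variance_of_integral_eq_zero (by fun_prop) (by simp)] at this
      simpa using this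
    rw [h1, map_apply_skMeasure, h2]
  · have h1 := integral_sign_mul (n := n) (fun a b => if a = i ∧ b = j then -1 else 1)
      (fun a b => by split_ifs <;> simp) (f := fun w => w i j * w k l)
      ((measurable_apply_apply i j).mul (measurable_apply_apply k l)).stronglyMeasurable
    have h2 : ¬ (k = i ∧ l = j) := fun hh => h ⟨hh.1.symm, hh.2.symm⟩
    simp only [and_self, if_true, h2, if_false, neg_mul, one_mul, integral_neg] at h1
    linarith

/-- The covariance of the energies of two configurations is a function of their overlap. -/
lemma integral_Ham_mul_Ham (σ τ : Fin n → Bool) :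
    ∫ w, Ham w σ * Ham w τ ∂(skMeasure n) =
      (∑ i, spin (σ i) * spin (τ i)) ^ 2 / (2 * n) := by
  have hint : ∀ i j k l : Fin n, Integrable (fun w : Fin n → Fin n → ℝ =>
      w i j * spin (σ i) * spin (σ j) * (w k l * spin (τ k) * spin (τ l))) (skMeasure n) := by
    intro i j k l
    have := ((memLp_apply_skMeasure i j).integrable_mul (memLp_apply_skMeasure k l)).const_mul
      (spin (σ i) * spin (σ j) * (spin (τ k) * spin (τ l)))
    refine this.congr (ae_of_all _ fun w => ?_)
    simp only [Pi.mul_apply]; ring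
  have hval : ∀ i j k l : Fin n, ∫ w : Fin n → Fin n → ℝ,
      w i j * spin (σ i) * spin (σ j) * (w k l * spin (τ k) * spin (τ l)) ∂(skMeasure n) =
      if i = k ∧ j = l then
        spin (σ i) * spin (τ k) * (spin (σ j) * spin (τ l)) * (1 / (2 * (n : ℝ))) else 0 := by
    intro i j k l
    have : ∀ w : Fin n → Fin n → ℝ,
        w i j * spin (σ i) * spin (σ j) * (w k l * spin (τ k) * spin (τ l)) =
        (spin (σ i) * spin (τ k) * (spin (σ j) * spin (τ l))) * (w i j * w k l) := by
      intro w; ring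
    simp_rw [this, integral_const_mul, integral_apply_mul_apply, mul_ite, mul_zero]
  simp only [Ham]
  have e : ∀ w : Fin n → Fin n → ℝ,
      (∑ i, ∑ j, w i j * spin (σ i) * spin (σ j)) * (∑ i, ∑ j, w i j * spin (τ i) * spin (τ j)) =
      ∑ i, ∑ j, ∑ k, ∑ l, w i j * spin (σ i) * spin (σ j) * (w k l * spin (τ k) * spin (τ l)) := by
    intro w
    simp_rw [Finset.sum_mul, Finset.mul_sum]
  simp_rw [e]
  rw [integral_finsetSum _ fun i _ => integrable_finsetSum _ fun j _ =>
    integrable_finsetSum _ fun k _ => integrable_finsetSum _ fun l _ => hint i j k l]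
  simp_rw [integral_finsetSum _ fun j _ =>
    integrable_finsetSum _ fun k _ => integrable_finsetSum _ fun l _ => hint _ j k l,
    integral_finsetSum _ fun k _ => integrable_finsetSum _ fun l _ => hint _ _ k l,
    integral_finsetSum _ fun l _ => hint _ _ _ l, hval]
  have : ∀ i j : Fin n, (∑ k, ∑ l, if i = k ∧ j = l then
        spin (σ i) * spin (τ k) * (spin (σ j) * spin (τ l)) * (1 / (2 * (n : ℝ))) else 0) =
        spin (σ i) * spin (τ i) * (spin (σ j) * spin (τ j)) * (1 / (2 * (n : ℝ))) := by
    intro i j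
    simp [ite_and, Finset.sum_ite_eq]
  simp_rw [this]
  rw [sq, Finset.sum_mul_sum, Finset.sum_div]
  refine Finset.sum_congr rfl fun i _ => ?_
  rw [Finset.sum_div]
  exact Finset.sum_congr rfl fun j _ => by ring

end SKDisorder

section Gibbs

variable {n : ℕ}

lemma Zpart_pos (β : ℝ) (X : Fin n → Fin n → ℝ) : 0 < Zpart β X :=
  Finset.sum_pos (fun _ _ => Real.exp_pos _) Finset.univ_nonempty

lemma gibbs_pos (β : ℝ) (X : Fin n → Fin n → ℝ) (σ : Fin n → Bool) : 0 < gibbs β X σ :=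
  div_pos (Real.exp_pos _) (Zpart_pos β X)

lemma sum_gibbs (β : ℝ) (X : Fin n → Fin n → ℝ) : ∑ σ, gibbs β X σ = 1 := by
  unfold gibbs
  rw [← Finset.sum_div]
  exact div_self (Zpart_pos β X).ne'

lemma gibbs_le_one (β : ℝ) (X : Fin n → Fin n → ℝ) (σ : Fin n → Bool) : gibbs β X σ ≤ 1 := by
  rw [← sum_gibbs β X]
  exact Finset.single_le_sum (fun τ _ => (gibbs_pos β X τ).le) (Finset.mem_univ σ)

lemma abs_gibbs_le_one (β : ℝ) (X : Fin n → Fin n → ℝ) (σ : Fin n → Bool) : |gibbs β X σ| ≤ 1 := by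
  rw [abs_of_pos (gibbs_pos β X σ)]
  exact gibbs_le_one β X σ

/-- The energy of a configuration as a continuous linear functional of the disorder. -/
noncomputable def HamL (σ : Fin n → Bool) : (Fin n → Fin n → ℝ) →L[ℝ] ℝ :=
  ∑ i, ∑ j, (spin (σ i) * spin (σ j)) •
    ((ContinuousLinearMap.proj j : (Fin n → ℝ) →L[ℝ] ℝ).comp
      (ContinuousLinearMap.proj i : (Fin n → Fin n → ℝ) →L[ℝ] (Fin n → ℝ)))

lemma HamL_apply (σ : Fin n → Bool) (X : Fin n → Fin n → ℝ) : HamL σ X = Ham X σ := by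
  simp only [HamL, Ham, sum_apply, smul_apply,
    ContinuousLinearMap.comp_apply, ContinuousLinearMap.proj_apply, smul_eq_mul]
  exact Finset.sum_congr rfl fun i _ => Finset.sum_congr rfl fun j _ => by ring

lemma continuous_Ham (σ : Fin n → Bool) : Continuous fun X : Fin n → Fin n → ℝ => Ham X σ := by
  simp_rw [← HamL_apply]
  exact (HamL σ).continuous

lemma continuous_Zpart (β : ℝ) : Continuous fun X : Fin n → Fin n → ℝ => Zpart β X :=
  continuous_finsetSum _ fun σ _ =>
    Real.continuous_exp.comp (continuous_const.mul (continuous_Ham σ))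

lemma continuous_gibbs (β : ℝ) (σ : Fin n → Bool) :
    Continuous fun X : Fin n → Fin n → ℝ => gibbs β X σ :=
  (Real.continuous_exp.comp (continuous_const.mul (continuous_Ham σ))).div (continuous_Zpart β)
    fun X => ne_of_gt (Zpart_pos β X)

/-- The derivative of a Gibbs weight with respect to the disorder. -/
noncomputable def gibbsDeriv (β : ℝ) (σ : Fin n → Bool) (X : Fin n → Fin n → ℝ) :
    (Fin n → Fin n → ℝ) →L[ℝ] ℝ :=
  (-β * gibbs β X σ) • (HamL σ - ∑ τ, gibbs β X τ • HamL τ)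

lemma gibbsDeriv_apply (β : ℝ) (σ : Fin n → Bool) (X w : Fin n → Fin n → ℝ) :
    gibbsDeriv β σ X w = -β * gibbs β X σ * (Ham w σ - ∑ τ, gibbs β X τ * Ham w τ) := by
  simp [gibbsDeriv, HamL_apply]

lemma continuous_gibbsDeriv (β : ℝ) (σ : Fin n → Bool) : Continuous (gibbsDeriv (n := n) β σ) :=
  (continuous_const.mul (continuous_gibbs β σ)).smul
    (continuous_const.sub (continuous_finsetSum _ fun τ _ =>
      (continuous_gibbs β τ).smul continuous_const))

lemma norm_gibbsDeriv_le (β : ℝ) (σ : Fin n → Bool) (X : Fin n → Fin n → ℝ) :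
    ‖gibbsDeriv β σ X‖ ≤ |β| * (‖HamL σ‖ + ∑ τ : Fin n → Bool, ‖HamL τ‖) := by
  unfold gibbsDeriv
  rw [norm_smul, norm_mul, norm_neg, Real.norm_eq_abs, Real.norm_eq_abs]
  have h1 : ‖HamL σ - ∑ τ, gibbs β X τ • HamL τ‖ ≤ ‖HamL σ‖ + ∑ τ : Fin n → Bool, ‖HamL τ‖ := by
    refine (norm_sub_le _ _).trans (add_le_add le_rfl ((norm_sum_le _ _).trans ?_))
    refine Finset.sum_le_sum fun τ _ => ?_
    rw [norm_smul]
    exact mul_le_of_le_one_left (norm_nonneg _) (abs_gibbs_le_one β X τ)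
  refine mul_le_mul ?_ h1 (norm_nonneg _) (abs_nonneg _)
  exact mul_le_of_le_one_right (abs_nonneg _) (abs_gibbs_le_one β X σ)

lemma hasFDerivAt_gibbs (β : ℝ) (σ : Fin n → Bool) (X : Fin n → Fin n → ℝ) :
    HasFDerivAt (fun X => gibbs β X σ) (gibbsDeriv β σ X) X := by
  have hH : ∀ τ : Fin n → Bool, HasFDerivAt (fun X => Real.exp (-β * Ham X τ))
      (Real.exp (-β * Ham X τ) • (-β) • HamL τ) X := by
    intro τ
    have : HasFDerivAt (fun X => Ham X τ) (HamL τ) X := by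
      simp_rw [← HamL_apply]
      exact (HamL τ).hasFDerivAt
    exact (this.const_mul (-β)).exp
  have hZ : HasFDerivAt (fun X : Fin n → Fin n → ℝ => Zpart β X)
      (∑ τ, Real.exp (-β * Ham X τ) • (-β) • HamL τ) X :=
    HasFDerivAt.fun_sum fun τ _ => hH τ
  have hne := (Zpart_pos β X).ne'
  have h := (hH σ).mul ((hasDerivAt_inv hne).comp_hasFDerivAt X hZ)
  refine h.congr_fderiv ?_
  ext1 w
  rw [gibbsDeriv_apply]
  simp only [smul_apply, add_apply, sum_apply, smul_eq_mul, HamL_apply,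
    Function.comp_apply]
  have e : ∑ τ, gibbs β X τ * Ham w τ =
      (∑ τ, Real.exp (-β * Ham X τ) * Ham w τ) / Zpart β X := by
    rw [Finset.sum_div]
    exact Finset.sum_congr rfl fun τ _ => by unfold gibbs; ring
  have e2 : ∑ τ, Real.exp (-β * Ham X τ) * (-β * Ham w τ) =
      -β * ∑ τ, Real.exp (-β * Ham X τ) * Ham w τ := by
    rw [Finset.mul_sum]
    exact Finset.sum_congr rfl fun τ _ => by ring
  rw [e, e2, gibbs]
  field_simp
  ring

/-- The unnormalised squared overlap. -/
noncomputable def sqOverlap (σ τ : Fin n → Bool) : ℝ := (∑ i, spin (σ i) * spin (τ i)) ^ 2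

lemma sqOverlap_nonneg (σ τ : Fin n → Bool) : 0 ≤ sqOverlap σ τ := sq_nonneg _

lemma integrable_Ham_mul_Ham (σ τ : Fin n → Bool) :
    Integrable (fun w => Ham w σ * Ham w τ) (skMeasure n) := by
  simp_rw [← HamL_apply]
  exact (IsGaussian.memLp_dual _ (HamL σ) 2 (by norm_num)).integrable_mul
    (IsGaussian.memLp_dual _ (HamL τ) 2 (by norm_num))

lemma integral_gibbsDeriv_mul_gibbsDeriv (β : ℝ) (σ τ : Fin n → Bool) (X Y : Fin n → Fin n → ℝ) :
    ∫ w, gibbsDeriv β σ X w * gibbsDeriv β τ Y w ∂(skMeasure n) =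
      β ^ 2 / (2 * n) * (gibbs β X σ * gibbs β Y τ *
        (sqOverlap σ τ - ∑ τ', gibbs β Y τ' * sqOverlap σ τ' - ∑ σ', gibbs β X σ' * sqOverlap σ' τ
          + ∑ σ', ∑ τ', gibbs β X σ' * gibbs β Y τ' * sqOverlap σ' τ')) := by
  have hI : ∀ a b : Fin n → Bool, ∫ w, Ham w a * Ham w b ∂(skMeasure n) =
      sqOverlap a b / (2 * n) := fun a b => integral_Ham_mul_Ham a b
  have hi := integrable_Ham_mul_Ham (n := n)
  have e : ∀ w, gibbsDeriv β σ X w * gibbsDeriv β τ Y w =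
      β ^ 2 * (gibbs β X σ * gibbs β Y τ) * (Ham w σ * Ham w τ
        - ∑ τ', gibbs β Y τ' * (Ham w σ * Ham w τ') - ∑ σ', gibbs β X σ' * (Ham w σ' * Ham w τ)
        + ∑ σ', ∑ τ', gibbs β X σ' * gibbs β Y τ' * (Ham w σ' * Ham w τ')) := by
    intro w
    have e1 : ∑ τ', gibbs β Y τ' * (Ham w σ * Ham w τ') =
        Ham w σ * ∑ τ', gibbs β Y τ' * Ham w τ' := by
      rw [Finset.mul_sum]; exact Finset.sum_congr rfl fun _ _ => by ring
    have e2 : ∑ σ', gibbs β X σ' * (Ham w σ' * Ham w τ) =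
        (∑ σ', gibbs β X σ' * Ham w σ') * Ham w τ := by
      rw [Finset.sum_mul]; exact Finset.sum_congr rfl fun _ _ => by ring
    have e3 : ∑ σ', ∑ τ', gibbs β X σ' * gibbs β Y τ' * (Ham w σ' * Ham w τ') =
        (∑ σ', gibbs β X σ' * Ham w σ') * ∑ τ', gibbs β Y τ' * Ham w τ' := by
      rw [Finset.sum_mul_sum]
      exact Finset.sum_congr rfl fun _ _ => Finset.sum_congr rfl fun _ _ => by ring
    rw [gibbsDeriv_apply, gibbsDeriv_apply, e1, e2, e3]
    ring
  have i1 : Integrable (fun w => ∑ τ', gibbs β Y τ' * (Ham w σ * Ham w τ')) (skMeasure n) :=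
    integrable_finsetSum _ fun _ _ => (hi _ _).const_mul _
  have i2 : Integrable (fun w => ∑ σ', gibbs β X σ' * (Ham w σ' * Ham w τ)) (skMeasure n) :=
    integrable_finsetSum _ fun _ _ => (hi _ _).const_mul _
  have i3 : ∀ σ', Integrable (fun w => ∑ τ', gibbs β X σ' * gibbs β Y τ' *
      (Ham w σ' * Ham w τ')) (skMeasure n) :=
    fun σ' => integrable_finsetSum _ fun _ _ => (hi _ _).const_mul _
  have i4 : Integrable (fun w => ∑ σ', ∑ τ', gibbs β X σ' * gibbs β Y τ' *
      (Ham w σ' * Ham w τ')) (skMeasure n) := integrable_finsetSum _ fun σ' _ => i3 σ'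
  simp_rw [e, integral_const_mul]
  have i5 : Integrable (fun w => Ham w σ * Ham w τ - ∑ τ', gibbs β Y τ' * (Ham w σ * Ham w τ'))
      (skMeasure n) := (hi σ τ).sub i1
  rw [integral_add (i5.sub' i2) i4, integral_sub i5 i2,
    integral_sub (hi σ τ) i1, integral_finsetSum _ fun _ _ => (hi _ _).const_mul _,
    integral_finsetSum _ fun _ _ => (hi _ _).const_mul _, integral_finsetSum _ fun σ' _ => i3 σ']
  simp_rw [integral_finsetSum _ fun _ _ => (hi _ _).const_mul _, integral_const_mul, hI]
  simp_rw [← mul_div_assoc, ← Finset.sum_div]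
  ring

/-- Chebyshev's sum inequality for a product of two probability vectors. -/
lemma sum_mul_sum_le_of_exp {α : Type*} [Fintype α] {p q : α → ℝ} (hp : ∀ a, 0 ≤ p a)
    (hq : ∀ a, 0 ≤ q a) (hp1 : ∑ a, p a = 1) (hq1 : ∑ a, q a = 1) {K Q : α → α → ℝ}
    (hKQ : ∀ a b c d, 0 ≤ (K a b - K c d) * (Q a b - Q c d)) :
    (∑ a, ∑ b, K a b * (p a * q b)) * (∑ a, ∑ b, p a * q b * Q a b) ≤
      ∑ a, ∑ b, K a b * (p a * q b) * Q a b := by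
  have hnn : 0 ≤ ∑ u : α × α, ∑ v : α × α, p u.1 * q u.2 * (p v.1 * q v.2) *
      ((K u.1 u.2 - K v.1 v.2) * (Q u.1 u.2 - Q v.1 v.2)) :=
    Finset.sum_nonneg fun u _ => Finset.sum_nonneg fun v _ =>
      mul_nonneg (mul_nonneg (mul_nonneg (hp _) (hq _)) (mul_nonneg (hp _) (hq _))) (hKQ _ _ _ _)
  have h1 : ∑ u : α × α, p u.1 * q u.2 = 1 := by
    rw [Fintype.sum_prod_type]
    simp_rw [← Finset.mul_sum, hq1, mul_one, hp1]
  have key : ∑ u : α × α, ∑ v : α × α, p u.1 * q u.2 * (p v.1 * q v.2) *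
      ((K u.1 u.2 - K v.1 v.2) * (Q u.1 u.2 - Q v.1 v.2)) =
      2 * ((∑ u : α × α, K u.1 u.2 * (p u.1 * q u.2) * Q u.1 u.2) * ∑ u : α × α, p u.1 * q u.2) -
      2 * ((∑ u : α × α, K u.1 u.2 * (p u.1 * q u.2)) * ∑ u : α × α, p u.1 * q u.2 * Q u.1 u.2) := by
    have e1 := Finset.sum_mul_sum Finset.univ Finset.univ
      (fun u : α × α => K u.1 u.2 * (p u.1 * q u.2) * Q u.1 u.2) fun u : α × α => p u.1 * q u.2
    have e2 := Finset.sum_mul_sum Finset.univ Finset.univ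
      (fun u : α × α => p u.1 * q u.2) fun u : α × α => K u.1 u.2 * (p u.1 * q u.2) * Q u.1 u.2
    have e3 := Finset.sum_mul_sum Finset.univ Finset.univ
      (fun u : α × α => K u.1 u.2 * (p u.1 * q u.2)) fun u : α × α => p u.1 * q u.2 * Q u.1 u.2
    have e4 := Finset.sum_mul_sum Finset.univ Finset.univ
      (fun u : α × α => p u.1 * q u.2 * Q u.1 u.2) fun u : α × α => K u.1 u.2 * (p u.1 * q u.2)
    rw [two_mul, two_mul]
    nth_rewrite 2 [mul_comm]
    nth_rewrite 4 [mul_comm]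
    rw [e1, e2, e3, e4]
    simp_rw [← Finset.sum_add_distrib, ← Finset.sum_sub_distrib]
    exact Finset.sum_congr rfl fun u _ => Finset.sum_congr rfl fun v _ => by ring
  rw [key, h1, mul_one] at hnn
  simp_rw [Fintype.sum_prod_type] at hnn
  linarith

lemma exp_mul_sub_mul_sub_nonneg {l : ℝ} (hl : 0 ≤ l) (x y : ℝ) :
    0 ≤ (Real.exp (l * x) - Real.exp (l * y)) * (x - y) := by
  rcases le_total x y with h | h
  · exact mul_nonneg_of_nonpos_of_nonpos (sub_nonpos.2 (Real.exp_le_exp.2 (by gcongr)))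
      (sub_nonpos.2 h)
  · exact mul_nonneg (sub_nonneg.2 (Real.exp_le_exp.2 (by gcongr))) (sub_nonneg.2 h)

/-- The key comparison driving the monotonicity of the interpolation. -/
lemma sum_exp_mul_centered_le {α : Type*} [Fintype α] {p q : α → ℝ} (hp : ∀ a, 0 ≤ p a)
    (hq : ∀ a, 0 ≤ q a) (hp1 : ∑ a, p a = 1) (hq1 : ∑ a, q a = 1) {Q : α → α → ℝ}
    (hQ : ∀ a b, 0 ≤ Q a b) {l : ℝ} (hl : 0 ≤ l) :
    ∑ a, ∑ b, Real.exp (l * Q a b) * (p a * q b * (Q a b - ∑ b', q b' * Q a b'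
      - ∑ a', p a' * Q a' b + ∑ a', ∑ b', p a' * q b' * Q a' b')) ≤
      2 * ∑ a, ∑ b, Real.exp (l * Q a b) * (p a * q b) * Q a b := by
  have hch := sum_mul_sum_le_of_exp hp hq hp1 hq1 (K := fun a b => Real.exp (l * Q a b)) (Q := Q)
    fun a b c d => exp_mul_sub_mul_sub_nonneg hl _ _
  rw [two_mul]
  refine le_trans ?_ (add_le_add_right hch _)
  simp_rw [Finset.sum_mul, ← Finset.sum_add_distrib]
  refine Finset.sum_le_sum fun a _ => Finset.sum_le_sum fun b _ => ?_
  have h1 : 0 ≤ ∑ b', q b' * Q a b' := Finset.sum_nonneg fun _ _ => mul_nonneg (hq _) (hQ _ _)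
  have h2 : 0 ≤ ∑ a', p a' * Q a' b := Finset.sum_nonneg fun _ _ => mul_nonneg (hp _) (hQ _ _)
  have h3 : 0 ≤ Real.exp (l * Q a b) * (p a * q b) :=
    mul_nonneg (Real.exp_pos _).le (mul_nonneg (hp _) (hq _))
  nlinarith [mul_nonneg h3 h1, mul_nonneg h3 h2]

end Gibbs

section Interpolation

variable {n : ℕ}

/-- The annealed joint weight of two configurations under disorders at angle `θ`. -/
noncomputable def pairWeight (β θ : ℝ) (σ τ : Fin n → Bool) : ℝ :=
  ∫ p, gibbs β p.1 σ * gibbs β (Real.cos θ • p.1 + Real.sin θ • p.2) τ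
    ∂((skMeasure n).prod (skMeasure n))

lemma continuous_gibbs_rotation (β θ : ℝ) (τ : Fin n → Bool) :
    Continuous fun p : (Fin n → Fin n → ℝ) × (Fin n → Fin n → ℝ) =>
      gibbs β (Real.cos θ • p.1 + Real.sin θ • p.2) τ :=
  (continuous_gibbs β τ).comp (by fun_prop)

lemma integrable_gibbs_mul_gibbs (β θ : ℝ) (σ τ : Fin n → Bool) :
    Integrable (fun p => gibbs β p.1 σ * gibbs β (Real.cos θ • p.1 + Real.sin θ • p.2) τ)
      ((skMeasure n).prod (skMeasure n)) := by
  refine integrable_of_continuous_of_abs_le (C := 1)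
    (((continuous_gibbs β σ).comp continuous_fst).mul (continuous_gibbs_rotation β θ τ)) fun p => ?_
  rw [abs_mul]
  exact mul_le_one₀ (abs_gibbs_le_one _ _ _) (abs_nonneg _) (abs_gibbs_le_one _ _ _)

lemma hasDerivAt_pairWeight (β θ : ℝ) (σ τ : Fin n → Bool) :
    HasDerivAt (fun θ => pairWeight β θ σ τ)
      (-Real.sin θ * ∫ p, (∫ w, gibbsDeriv β σ p.1 w *
        gibbsDeriv β τ (Real.cos θ • p.1 + Real.sin θ • p.2) w ∂(skMeasure n))
          ∂((skMeasure n).prod (skMeasure n))) θ := by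
  obtain ⟨C, hC⟩ : ∃ C, ∀ x, ‖gibbsDeriv β σ x‖ ≤ C := ⟨_, norm_gibbsDeriv_le β σ⟩
  obtain ⟨D, hD⟩ : ∃ D, ∀ x, ‖gibbsDeriv β τ x‖ ≤ D := ⟨_, norm_gibbsDeriv_le β τ⟩
  exact hasDerivAt_integral_mul_rotation (C := max 1 (max C D))
    map_rotation_skMeasure memLp_id_skMeasure
    (hasFDerivAt_gibbs β σ) (continuous_gibbsDeriv β σ)
    (hasFDerivAt_gibbs β τ) (continuous_gibbsDeriv β τ)
    (fun x => (abs_gibbs_le_one β x σ).trans (le_max_left _ _))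
    (fun x => (hC x).trans ((le_max_left _ _).trans (le_max_right _ _)))
    (fun x => (abs_gibbs_le_one β x τ).trans (le_max_left _ _))
    (fun x => (hD x).trans ((le_max_right _ _).trans (le_max_right _ _))) θ

lemma integrable_integral_gibbsDeriv (β θ : ℝ) (σ τ : Fin n → Bool) :
    Integrable (fun p => ∫ w, gibbsDeriv β σ p.1 w *
        gibbsDeriv β τ (Real.cos θ • p.1 + Real.sin θ • p.2) w ∂(skMeasure n))
      ((skMeasure n).prod (skMeasure n)) := by
  obtain ⟨C, hC⟩ : ∃ C, ∀ x, ‖gibbsDeriv β σ x‖ ≤ C := ⟨_, norm_gibbsDeriv_le β σ⟩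
  obtain ⟨D, hD⟩ : ∃ D, ∀ x, ‖gibbsDeriv β τ x‖ ≤ D := ⟨_, norm_gibbsDeriv_le β τ⟩
  have hC0 : 0 ≤ C := (norm_nonneg _).trans (hC 0)
  have hcont : Continuous fun p : (Fin n → Fin n → ℝ) × (Fin n → Fin n → ℝ) =>
      ∫ w, gibbsDeriv β σ p.1 w *
        gibbsDeriv β τ (Real.cos θ • p.1 + Real.sin θ • p.2) w ∂(skMeasure n) := by
    simp_rw [integral_gibbsDeriv_mul_gibbsDeriv]
    have h1 : ∀ σ : Fin n → Bool, Continuous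
        fun p : (Fin n → Fin n → ℝ) × (Fin n → Fin n → ℝ) => gibbs β p.1 σ :=
      fun σ => (continuous_gibbs β σ).comp continuous_fst
    have h2 := continuous_gibbs_rotation (n := n) β θ
    exact continuous_const.mul (((h1 σ).mul (h2 τ)).mul
      (((continuous_const.sub
        (continuous_finsetSum _ fun b _ => (h2 b).mul continuous_const)).sub
        (continuous_finsetSum _ fun a _ => (h1 a).mul continuous_const)).add
        (continuous_finsetSum _ fun a _ => continuous_finsetSum _ fun b _ =>
          ((h1 a).mul (h2 b)).mul continuous_const)))
  refine integrable_of_continuous_of_abs_le hcont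
    (C := ∫ w, C * ‖w‖ * (D * ‖w‖) ∂(skMeasure n)) fun p => ?_
  rw [← Real.norm_eq_abs]
  refine norm_integral_le_of_norm_le ?_ (ae_of_all _ fun w => ?_)
  · have h := (memLp_id_skMeasure (n := n)).norm.integrable_mul (memLp_id_skMeasure (n := n)).norm
    refine (h.const_mul (C * D)).congr (ae_of_all _ fun w => ?_)
    simp only [Pi.mul_apply, id]; ring
  · rw [norm_mul]
    exact mul_le_mul (((gibbsDeriv β σ _).le_opNorm w).trans (by gcongr; exact hC _))
      (((gibbsDeriv β τ _).le_opNorm w).trans (by gcongr; exact hD _)) (norm_nonneg _)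
      (by positivity)

/-- The interpolating exponential overlap moment. -/
noncomputable def expOverlap (n : ℕ) (β l θ : ℝ) : ℝ :=
  ∑ σ : Fin n → Bool, ∑ τ : Fin n → Bool, Real.exp (l / n * sqOverlap σ τ) * pairWeight β θ σ τ

lemma hasDerivAt_expOverlap (n : ℕ) (β l s θ : ℝ) :
    HasDerivAt (fun θ => expOverlap n β (l + β ^ 2 * (s - Real.cos θ)) θ)
      (Real.sin θ * ∑ σ : Fin n → Bool, ∑ τ : Fin n → Bool,
        Real.exp ((l + β ^ 2 * (s - Real.cos θ)) / n * sqOverlap σ τ) *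
        (β ^ 2 / n * sqOverlap σ τ * pairWeight β θ σ τ -
          ∫ p, (∫ w, gibbsDeriv β σ p.1 w *
            gibbsDeriv β τ (Real.cos θ • p.1 + Real.sin θ • p.2) w ∂(skMeasure n))
            ∂((skMeasure n).prod (skMeasure n)))) θ := by
  unfold expOverlap
  have key : ∀ σ τ : Fin n → Bool, HasDerivAt (fun θ =>
      Real.exp ((l + β ^ 2 * (s - Real.cos θ)) / n * sqOverlap σ τ) * pairWeight β θ σ τ)
      (Real.sin θ * (Real.exp ((l + β ^ 2 * (s - Real.cos θ)) / n * sqOverlap σ τ) *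
        (β ^ 2 / n * sqOverlap σ τ * pairWeight β θ σ τ -
          ∫ p, (∫ w, gibbsDeriv β σ p.1 w *
            gibbsDeriv β τ (Real.cos θ • p.1 + Real.sin θ • p.2) w ∂(skMeasure n))
            ∂((skMeasure n).prod (skMeasure n))))) θ := by
    intro σ τ
    have h1 : HasDerivAt (fun θ => (l + β ^ 2 * (s - Real.cos θ)) / n * sqOverlap σ τ)
        (β ^ 2 * Real.sin θ / n * sqOverlap σ τ) θ := by
      have := (((((Real.hasDerivAt_cos θ).const_sub s).const_mul (β ^ 2)).const_add l).div_const
        (n : ℝ)).mul_const (sqOverlap σ τ)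
      simpa using this
    refine (h1.exp.mul (hasDerivAt_pairWeight β θ σ τ)).congr_deriv ?_
    ring
  simp_rw [Finset.mul_sum]
  exact HasDerivAt.fun_sum fun σ _ => HasDerivAt.fun_sum fun τ _ => key σ τ

lemma expOverlap_deriv_nonneg (n : ℕ) (β θ : ℝ) {m : ℝ} (hm : 0 ≤ m) :
    0 ≤ ∑ σ : Fin n → Bool, ∑ τ : Fin n → Bool,
        Real.exp (m / n * sqOverlap σ τ) *
        (β ^ 2 / n * sqOverlap σ τ * pairWeight β θ σ τ -
          ∫ p, (∫ w, gibbsDeriv β σ p.1 w *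
            gibbsDeriv β τ (Real.cos θ • p.1 + Real.sin θ • p.2) w ∂(skMeasure n))
            ∂((skMeasure n).prod (skMeasure n))) := by
  have hi1 : ∀ σ τ : Fin n → Bool, Integrable (fun p => Real.exp (m / n * sqOverlap σ τ) *
        (β ^ 2 / n * sqOverlap σ τ * (gibbs β p.1 σ *
          gibbs β (Real.cos θ • p.1 + Real.sin θ • p.2) τ) -
          ∫ w, gibbsDeriv β σ p.1 w *
            gibbsDeriv β τ (Real.cos θ • p.1 + Real.sin θ • p.2) w ∂(skMeasure n)))
      ((skMeasure n).prod (skMeasure n)) := fun σ τ =>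
    (((integrable_gibbs_mul_gibbs β θ σ τ).const_mul _).sub'
      (integrable_integral_gibbsDeriv β θ σ τ)).const_mul _
  have heq : ∑ σ : Fin n → Bool, ∑ τ : Fin n → Bool,
        Real.exp (m / n * sqOverlap σ τ) *
        (β ^ 2 / n * sqOverlap σ τ * pairWeight β θ σ τ -
          ∫ p, (∫ w, gibbsDeriv β σ p.1 w *
            gibbsDeriv β τ (Real.cos θ • p.1 + Real.sin θ • p.2) w ∂(skMeasure n))
            ∂((skMeasure n).prod (skMeasure n))) =
      ∫ p, ∑ σ : Fin n → Bool, ∑ τ : Fin n → Bool, Real.exp (m / n * sqOverlap σ τ) *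
        (β ^ 2 / n * sqOverlap σ τ * (gibbs β p.1 σ *
          gibbs β (Real.cos θ • p.1 + Real.sin θ • p.2) τ) -
          ∫ w, gibbsDeriv β σ p.1 w *
            gibbsDeriv β τ (Real.cos θ • p.1 + Real.sin θ • p.2) w ∂(skMeasure n))
        ∂((skMeasure n).prod (skMeasure n)) := by
    rw [integral_finsetSum _ fun σ _ => integrable_finsetSum _ fun τ _ => hi1 σ τ]
    refine Finset.sum_congr rfl fun σ _ => ?_
    rw [integral_finsetSum _ fun τ _ => hi1 σ τ]
    refine Finset.sum_congr rfl fun τ _ => ?_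
    rw [integral_const_mul, integral_sub ((integrable_gibbs_mul_gibbs β θ σ τ).const_mul _)
      (integrable_integral_gibbsDeriv β θ σ τ), integral_const_mul, pairWeight]
  rw [heq]
  refine integral_nonneg fun p => ?_
  simp only [Pi.zero_apply, integral_gibbsDeriv_mul_gibbsDeriv]
  set X := p.1
  set Y := Real.cos θ • p.1 + Real.sin θ • p.2
  have h := sum_exp_mul_centered_le (fun a => (gibbs_pos β X a).le) (fun a => (gibbs_pos β Y a).le)
    (sum_gibbs β X) (sum_gibbs β Y) (Q := sqOverlap) sqOverlap_nonneg (l := m / n)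
    (by positivity)
  have h2 := mul_le_mul_of_nonneg_left h (show 0 ≤ β ^ 2 / (2 * n) by positivity)
  refine le_of_le_of_eq (sub_nonneg.2 h2) ?_
  simp_rw [Finset.mul_sum, ← Finset.sum_sub_distrib]
  exact Finset.sum_congr rfl fun _ _ => Finset.sum_congr rfl fun _ _ => by ring

/-- Decorrelating the disorders costs at most a shift of the exponential parameter. -/
lemma expOverlap_le_expOverlap_pi_div_two (n : ℕ) (β : ℝ) {l s : ℝ} (hl : 0 ≤ l) (hs0 : 0 ≤ s)
    (hs1 : s ≤ 1) :
    expOverlap n β l (Real.arccos s) ≤ expOverlap n β (l + β ^ 2 * s) (Real.pi / 2) := by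
  have hd := hasDerivAt_expOverlap n β l s
  have ha : Real.arccos s ≤ Real.pi / 2 := by rwa [Real.arccos_le_pi_div_two]
  have hmono : MonotoneOn (fun θ => expOverlap n β (l + β ^ 2 * (s - Real.cos θ)) θ)
      (Set.Icc (Real.arccos s) (Real.pi / 2)) := by
    refine monotoneOn_of_deriv_nonneg (convex_Icc _ _)
      (fun θ _ => (hd θ).continuousAt.continuousWithinAt)
      (fun θ _ => (hd θ).differentiableAt.differentiableWithinAt) fun θ hθ => ?_
    rw [(hd θ).deriv]
    rw [interior_Icc] at hθ
    have h0 := Real.arccos_nonneg s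
    have hpi := Real.pi_pos
    refine mul_nonneg (Real.sin_nonneg_of_nonneg_of_le_pi (h0.trans hθ.1.le) (by linarith [hθ.2])) ?_
    refine expOverlap_deriv_nonneg n β θ ?_
    have : Real.cos θ ≤ s := by
      have := Real.cos_le_cos_of_nonneg_of_le_pi h0 (by linarith [hθ.2]) hθ.1.le
      rwa [Real.cos_arccos (by linarith) hs1] at this
    have := mul_nonneg (sq_nonneg β) (sub_nonneg.2 this)
    linarith
  have := hmono ⟨le_rfl, ha⟩ ⟨ha, le_rfl⟩ ha
  simpa [Real.cos_arccos (by linarith : -1 ≤ s) hs1] using this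

end Interpolation

section Decoupled

variable {n : ℕ}

/-- The gauge transformation of configurations by `c`. -/
def gaugeFlip (c σ : Fin n → Bool) : Fin n → Bool := fun i => σ i == c i

lemma spin_beq (a b : Bool) : spin (a == b) = spin a * spin b := by
  cases a <;> cases b <;> simp [spin]

lemma gaugeFlip_involutive (c : Fin n → Bool) : Function.Involutive (gaugeFlip c) := by
  intro σ
  funext i
  simp only [gaugeFlip]
  cases σ i <;> cases c i <;> rfl

lemma Ham_gauge (c σ : Fin n → Bool) (y : Fin n → Fin n → ℝ) :
    Ham (fun i j => spin (c i) * spin (c j) * y i j) σ = Ham y (gaugeFlip c σ) := by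
  simp only [Ham, gaugeFlip, spin_beq]
  exact Finset.sum_congr rfl fun i _ => Finset.sum_congr rfl fun j _ => by ring

lemma gibbs_gauge (β : ℝ) (c σ : Fin n → Bool) (y : Fin n → Fin n → ℝ) :
    gibbs β (fun i j => spin (c i) * spin (c j) * y i j) σ = gibbs β y (gaugeFlip c σ) := by
  have hZ : Zpart β (fun i j => spin (c i) * spin (c j) * y i j) = Zpart β y := by
    simp only [Zpart, Ham_gauge]
    exact Equiv.sum_comp (gaugeFlip_involutive c).toPerm fun σ => Real.exp (-β * Ham y σ)
  rw [gibbs, gibbs, Ham_gauge, hZ]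

/-- The annealed Gibbs measure is uniform. -/
lemma integral_gibbs (β : ℝ) (σ : Fin n → Bool) :
    ∫ y, gibbs β y σ ∂(skMeasure n) = (2 ^ n)⁻¹ := by
  have hi : ∀ τ : Fin n → Bool, Integrable (fun y => gibbs β y τ) (skMeasure n) := fun τ =>
    integrable_of_continuous_of_abs_le (continuous_gibbs β τ) fun x => abs_gibbs_le_one β x τ
  have heq : ∀ τ : Fin n → Bool,
      ∫ y, gibbs β y τ ∂(skMeasure n) = ∫ y, gibbs β y σ ∂(skMeasure n) := by
    intro τ
    have h := integral_sign_mul (n := n)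
      (fun i j => spin (gaugeFlip σ τ i) * spin (gaugeFlip σ τ j))
      (fun i j => by
        rcases spin_eq_one_or (gaugeFlip σ τ i) with h | h <;>
        rcases spin_eq_one_or (gaugeFlip σ τ j) with h' | h' <;> simp [h, h'])
      (f := fun y => gibbs β y τ) (continuous_gibbs β τ).stronglyMeasurable
    rw [← h]
    simp_rw [gibbs_gauge]
    have : gaugeFlip (gaugeFlip σ τ) τ = σ := by
      funext i
      simp only [gaugeFlip]
      cases σ i <;> cases τ i <;> rfl
    rw [this]
  have hsum : ∑ τ : Fin n → Bool, ∫ y, gibbs β y τ ∂(skMeasure n) = 1 := by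
    rw [← integral_finsetSum _ fun τ _ => hi τ]
    simp [sum_gibbs]
  simp_rw [heq] at hsum
  simp only [Finset.sum_const, Finset.card_univ, Fintype.card_fun, Fintype.card_bool,
    Fintype.card_fin, nsmul_eq_mul, Nat.cast_pow, Nat.cast_ofNat] at hsum
  exact eq_inv_of_mul_eq_one_right hsum

lemma pairWeight_pi_div_two (β : ℝ) (σ τ : Fin n → Bool) :
    pairWeight β (Real.pi / 2) σ τ = (2 ^ n)⁻¹ * (2 ^ n)⁻¹ := by
  simp only [pairWeight, Real.cos_pi_div_two, Real.sin_pi_div_two, zero_smul, one_smul, zero_add]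
  rw [integral_prod_mul (fun x => gibbs β x σ) fun y => gibbs β y τ, integral_gibbs, integral_gibbs]

lemma integral_exp_mul_sub_sq {b : ℝ} (hb : 0 < b) (S : ℝ) :
    Integrable (fun z : ℝ => Real.exp (S * z - b * z ^ 2)) ∧
    ∫ z : ℝ, Real.exp (S * z - b * z ^ 2) = Real.exp (S ^ 2 / (4 * b)) * √(Real.pi / b) := by
  have e : (fun z : ℝ => Real.exp (S * z - b * z ^ 2)) =
      fun z => Real.exp (S ^ 2 / (4 * b)) * Real.exp (-b * (z - S / (2 * b)) ^ 2) := by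
    funext z
    rw [← Real.exp_add]
    congr 1
    field_simp
    ring
  rw [e]
  refine ⟨((integrable_exp_neg_mul_sq hb).comp_sub_right (S / (2 * b))).const_mul _, ?_⟩
  rw [integral_const_mul, integral_sub_right_eq_self (fun z => Real.exp (-b * z ^ 2)),
    integral_gaussian]

lemma sum_exp_mul_spin (τ : Fin n → Bool) (z : ℝ) :
    ∑ σ : Fin n → Bool, Real.exp ((∑ i, spin (σ i) * spin (τ i)) * z) = (2 * Real.cosh z) ^ n := by
  have h : ∀ σ : Fin n → Bool, Real.exp ((∑ i, spin (σ i) * spin (τ i)) * z) =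
      ∏ i, Real.exp (spin (σ i) * spin (τ i) * z) := by
    intro σ
    rw [Finset.sum_mul, Real.exp_sum]
  simp_rw [h]
  have h2 := Finset.prod_univ_sum (fun _ : Fin n => (Finset.univ : Finset Bool))
    fun i b => Real.exp (spin b * spin (τ i) * z)
  rw [Fintype.piFinset_univ] at h2
  rw [← h2]
  have h3 : ∀ i, ∑ b : Bool, Real.exp (spin b * spin (τ i) * z) = 2 * Real.cosh z := by
    intro i
    rw [Real.cosh_eq]
    cases τ i <;> simp [spin] <;> ring
  simp only [h3, Finset.prod_const, Finset.card_univ, Fintype.card_fin]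

/-- The exponential moment of the squared overlap with a uniform configuration. -/
lemma sum_exp_sqOverlap_le (hn : 0 < n) (τ : Fin n → Bool) :
    ∑ σ : Fin n → Bool, Real.exp (1 / 4 / n * sqOverlap σ τ) ≤ 2 * 2 ^ n := by
  have hn' : (0 : ℝ) < n := by exact_mod_cast hn
  have hsq : 0 < √(Real.pi / n) := Real.sqrt_pos.2 (by positivity)
  have h1 : ∀ σ : Fin n → Bool, Real.exp (1 / 4 / n * sqOverlap σ τ) * √(Real.pi / n) =
      ∫ z : ℝ, Real.exp ((∑ i, spin (σ i) * spin (τ i)) * z - n * z ^ 2) := by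
    intro σ
    rw [(integral_exp_mul_sub_sq hn' _).2, sqOverlap]
    congr 2
    field_simp
  have h2 : (∑ σ : Fin n → Bool, Real.exp (1 / 4 / n * sqOverlap σ τ)) * √(Real.pi / n) ≤
      2 ^ n * √(Real.pi / (n / 2)) := by
    rw [Finset.sum_mul]
    simp_rw [h1]
    rw [← integral_finsetSum _ fun σ _ => (integral_exp_mul_sub_sq hn' _).1, ← integral_gaussian,
      ← integral_const_mul]
    refine integral_mono (integrable_finsetSum _ fun σ _ => (integral_exp_mul_sub_sq hn' _).1)
      ((integrable_exp_neg_mul_sq (by positivity)).const_mul _) fun z => ?_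
    simp only
    simp_rw [Real.exp_sub, ← Finset.sum_div]
    rw [sum_exp_mul_spin, div_le_iff₀ (Real.exp_pos _), mul_assoc, ← Real.exp_add, mul_pow]
    gcongr
    calc Real.cosh z ^ n ≤ Real.exp (z ^ 2 / 2) ^ n := by
          gcongr
          exact Real.cosh_le_exp_half_sq z
      _ = Real.exp (-(n / 2) * z ^ 2 + n * z ^ 2) := by
          rw [← Real.exp_nat_mul]; congr 1; ring
  have h3 : √(Real.pi / (n / 2)) ≤ 2 * √(Real.pi / n) := by
    rw [Real.sqrt_le_left (by positivity), mul_pow, Real.sq_sqrt (by positivity)]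
    have : 0 ≤ Real.pi / n := by positivity
    have e : Real.pi / (n / 2) = 2 * (Real.pi / n) := by field_simp
    rw [e]; linarith
  have h4 : (∑ σ : Fin n → Bool, Real.exp (1 / 4 / n * sqOverlap σ τ)) * √(Real.pi / n) ≤
      2 * 2 ^ n * √(Real.pi / n) := by
    refine h2.trans ?_
    have := mul_le_mul_of_nonneg_left h3 (show (0 : ℝ) ≤ 2 ^ n by positivity)
    linarith
  exact le_of_mul_le_mul_right h4 hsq

lemma expOverlap_pi_div_two_le (hn : 0 < n) (β : ℝ) {l : ℝ} (hl : l ≤ 1 / 4) :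
    expOverlap n β l (Real.pi / 2) ≤ 2 := by
  have h : expOverlap n β l (Real.pi / 2) ≤ ∑ τ : Fin n → Bool, 2 * 2 ^ n * ((2 ^ n)⁻¹ * (2 ^ n)⁻¹) := by
    unfold expOverlap
    rw [Finset.sum_comm]
    refine Finset.sum_le_sum fun τ _ => ?_
    simp_rw [pairWeight_pi_div_two]
    rw [← Finset.sum_mul]
    refine mul_le_mul_of_nonneg_right (le_trans (Finset.sum_le_sum fun σ _ => ?_)
      (sum_exp_sqOverlap_le hn τ)) (by positivity)
    have := sqOverlap_nonneg σ τ
    gcongr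
  refine h.trans (le_of_eq ?_)
  simp only [Finset.sum_const, Finset.card_univ, Fintype.card_fun, Fintype.card_bool,
    Fintype.card_fin, nsmul_eq_mul, Nat.cast_pow, Nat.cast_ofNat]
  field_simp

/-- At small correlation the overlap is of order `n ^ (-1/2)`. -/
lemma expOverlap_le_two (hn : 0 < n) {β s : ℝ} (hs0 : 0 ≤ s) (hs1 : s ≤ 1)
    (hβ : β ^ 2 * s ≤ 1 / 8) : expOverlap n β (1 / 8) (Real.arccos s) ≤ 2 :=
  (expOverlap_le_expOverlap_pi_div_two n β (by norm_num) hs0 hs1).trans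
    (expOverlap_pi_div_two_le hn β (by linarith))

end Decoupled

section Tail

variable {n : ℕ}

/-- The annealed even moments of the overlap at correlation `s`. -/
noncomputable def overlapMoment (n : ℕ) (β : ℝ) (k : ℕ) (s : ℝ) : ℝ :=
  ∑ σ : Fin n → Bool, ∑ τ : Fin n → Bool,
    overlap σ τ ^ (2 * k) * pairWeight β (Real.arccos s) σ τ

lemma pairWeight_nonneg (β θ : ℝ) (σ τ : Fin n → Bool) : 0 ≤ pairWeight β θ σ τ :=
  integral_nonneg fun _ => mul_nonneg (gibbs_pos _ _ _).le (gibbs_pos _ _ _).le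

lemma overlapMoment_nonneg (n : ℕ) (β : ℝ) (k : ℕ) (s : ℝ) : 0 ≤ overlapMoment n β k s :=
  Finset.sum_nonneg fun _ _ => Finset.sum_nonneg fun _ _ =>
    mul_nonneg ((even_two_mul k).pow_nonneg _) (pairWeight_nonneg _ _ _ _)

/-- The Gibbs average of a product of spins. -/
noncomputable def spinCorrelation (β : ℝ) {m : ℕ} (I : Fin m → Fin n) (X : Fin n → Fin n → ℝ) : ℝ :=
  ∑ σ : Fin n → Bool, (∏ l, spin (σ (I l))) * gibbs β X σ

lemma continuous_spinCorrelation (β : ℝ) {m : ℕ} (I : Fin m → Fin n) :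
    Continuous (spinCorrelation β I) :=
  continuous_finsetSum _ fun σ _ => continuous_const.mul (continuous_gibbs β σ)

lemma abs_spinCorrelation_le_one (β : ℝ) {m : ℕ} (I : Fin m → Fin n) (X : Fin n → Fin n → ℝ) :
    |spinCorrelation β I X| ≤ 1 := by
  rw [← sum_gibbs β X]
  refine (Finset.abs_sum_le_sum_abs _ _).trans (Finset.sum_le_sum fun σ _ => ?_)
  rw [abs_mul, Finset.abs_prod, abs_of_pos (gibbs_pos β X σ)]
  simp [abs_spin]

lemma pow_mul_overlapMoment_eq (hn : 0 < n) (β : ℝ) (k : ℕ) {s : ℝ} (hs0 : 0 ≤ s) (hs1 : s ≤ 1) :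
    (n : ℝ) ^ (2 * k) * overlapMoment n β k s = ∑ I : Fin (2 * k) → Fin n,
      ∫ p, spinCorrelation β I p.1 * spinCorrelation β I (s • p.1 + √(1 - s ^ 2) • p.2)
        ∂((skMeasure n).prod (skMeasure n)) := by
  have hn' : (n : ℝ) ≠ 0 := by positivity
  have hcos : Real.cos (Real.arccos s) = s := Real.cos_arccos (by linarith) hs1
  have hsin : Real.sin (Real.arccos s) = √(1 - s ^ 2) := Real.sin_arccos s
  have hint := fun σ τ : Fin n → Bool => integrable_gibbs_mul_gibbs β (Real.arccos s) σ τ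
  rw [hcos, hsin] at hint
  have h1 : ∀ I : Fin (2 * k) → Fin n,
      ∫ p, spinCorrelation β I p.1 * spinCorrelation β I (s • p.1 + √(1 - s ^ 2) • p.2)
        ∂((skMeasure n).prod (skMeasure n)) =
      ∑ σ : Fin n → Bool, ∑ τ : Fin n → Bool,
        (∏ l, spin (σ (I l)) * spin (τ (I l))) * pairWeight β (Real.arccos s) σ τ := by
    intro I
    have e : ∀ X Y : Fin n → Fin n → ℝ, spinCorrelation β I X * spinCorrelation β I Y =
        ∑ σ : Fin n → Bool, ∑ τ : Fin n → Bool,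
        (∏ l, spin (σ (I l)) * spin (τ (I l))) * (gibbs β X σ * gibbs β Y τ) := by
      intro X Y
      rw [spinCorrelation, spinCorrelation, Finset.sum_mul_sum]
      refine Finset.sum_congr rfl fun σ _ => Finset.sum_congr rfl fun τ _ => ?_
      rw [Finset.prod_mul_distrib]; ring
    simp_rw [e]
    rw [integral_finsetSum _ fun σ _ => integrable_finsetSum _ fun τ _ => (hint σ τ).const_mul _]
    refine Finset.sum_congr rfl fun σ _ => ?_
    rw [integral_finsetSum _ fun τ _ => (hint σ τ).const_mul _]
    refine Finset.sum_congr rfl fun τ _ => ?_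
    rw [integral_const_mul, pairWeight, hcos, hsin]
  simp_rw [h1]
  rw [Finset.sum_comm, overlapMoment, Finset.mul_sum]
  refine Finset.sum_congr rfl fun σ _ => ?_
  rw [Finset.sum_comm, Finset.mul_sum]
  refine Finset.sum_congr rfl fun τ _ => ?_
  rw [← Finset.sum_mul, ← Fintype.sum_pow (fun i => spin (σ i) * spin (τ i)), overlap, mul_pow,
    ← mul_assoc, ← mul_assoc, ← mul_pow, mul_one_div_cancel hn', one_pow, one_mul]

/-- Squaring the correlation of the disorders at most squares the overlap moments. -/
lemma overlapMoment_sq_le (hn : 0 < n) (β : ℝ) (k : ℕ) {s : ℝ} (hs0 : 0 ≤ s) (hs1 : s ≤ 1) :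
    overlapMoment n β k s ^ 2 ≤ overlapMoment n β k (s ^ 2) := by
  have h := sq_sum_noise_correlation_le (μ := skMeasure n) map_rotation_skMeasure
    (F := fun I : Fin (2 * k) → Fin n => spinCorrelation β I)
    (continuous_spinCorrelation β) (abs_spinCorrelation_le_one β) hs0 hs1
  rw [← pow_mul_overlapMoment_eq hn β k hs0 hs1,
    ← pow_mul_overlapMoment_eq hn β k (by positivity) (pow_le_one₀ hs0 hs1)] at h
  simp only [Fintype.card_fun, Fintype.card_fin, Nat.cast_pow] at h
  have hpos : (0 : ℝ) < ((n : ℝ) ^ (2 * k)) ^ 2 := by positivity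
  refine le_of_mul_le_mul_left ?_ hpos
  calc _ = ((n : ℝ) ^ (2 * k) * overlapMoment n β k s) ^ 2 := by ring
    _ ≤ _ := h
    _ = _ := by ring

lemma overlapMoment_pow_le (hn : 0 < n) (β : ℝ) (k : ℕ) {s : ℝ} (hs0 : 0 ≤ s) (hs1 : s ≤ 1)
    (j : ℕ) : overlapMoment n β k s ^ 2 ^ j ≤ overlapMoment n β k (s ^ 2 ^ j) := by
  induction j with
  | zero => simp
  | succ j ih =>
    rw [pow_succ, pow_mul, pow_mul]
    exact (pow_le_pow_left₀ (pow_nonneg (overlapMoment_nonneg _ _ _ _) _) ih 2).trans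
      (overlapMoment_sq_le hn β k (by positivity) (pow_le_one₀ hs0 hs1))

lemma overlapMoment_le_expOverlap (hn : 0 < n) (β : ℝ) (k : ℕ) (s : ℝ) :
    overlapMoment n β k s ≤ (8 * k / n) ^ k * expOverlap n β (1 / 8) (Real.arccos s) := by
  have hn' : (0 : ℝ) < n := by exact_mod_cast hn
  rw [overlapMoment, expOverlap, Finset.mul_sum]
  refine Finset.sum_le_sum fun σ _ => ?_
  rw [Finset.mul_sum]
  refine Finset.sum_le_sum fun τ _ => ?_
  rw [← mul_assoc]
  refine mul_le_mul_of_nonneg_right ?_ (pairWeight_nonneg _ _ _ _)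
  have hx : 0 ≤ 1 / 8 / n * sqOverlap σ τ := mul_nonneg (by positivity) (sqOverlap_nonneg _ _)
  have h1 := Real.pow_div_factorial_le_exp _ hx k
  rw [div_le_iff₀ (by positivity)] at h1
  have h2 : (k.factorial : ℝ) ≤ (k : ℝ) ^ k := by exact_mod_cast Nat.factorial_le_pow k
  have e : overlap σ τ ^ (2 * k) = (8 / n) ^ k * (1 / 8 / n * sqOverlap σ τ) ^ k := by
    rw [← mul_pow, pow_mul, overlap, sqOverlap]
    congr 1
    field_simp
  rw [e]
  calc (8 / (n : ℝ)) ^ k * (1 / 8 / n * sqOverlap σ τ) ^ k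
      ≤ (8 / (n : ℝ)) ^ k * (Real.exp (1 / 8 / n * sqOverlap σ τ) * (k : ℝ) ^ k) := by
        gcongr
        exact h1.trans (by gcongr)
    _ = _ := by
        rw [div_pow, div_pow, mul_pow]; ring

open scoped Classical in
/-- The annealed probability that the overlap is at least `ε` in absolute value. -/
noncomputable def overlapTail (n : ℕ) (β ε s : ℝ) : ℝ :=
  ∑ σ : Fin n → Bool, ∑ τ : Fin n → Bool,
    if ε ≤ |overlap σ τ| then pairWeight β (Real.arccos s) σ τ else 0

lemma overlapTail_nonneg (n : ℕ) (β ε s : ℝ) : 0 ≤ overlapTail n β ε s :=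
  Finset.sum_nonneg fun _ _ => Finset.sum_nonneg fun _ _ => by
    split_ifs
    exacts [pairWeight_nonneg _ _ _ _, le_rfl]

lemma pow_mul_overlapTail_le (n : ℕ) (β : ℝ) {ε : ℝ} (hε : 0 ≤ ε) (k : ℕ) (s : ℝ) :
    ε ^ (2 * k) * overlapTail n β ε s ≤ overlapMoment n β k s := by
  rw [overlapTail, overlapMoment, Finset.mul_sum]
  refine Finset.sum_le_sum fun σ _ => ?_
  rw [Finset.mul_sum]
  refine Finset.sum_le_sum fun τ _ => ?_
  split_ifs with h
  · refine mul_le_mul_of_nonneg_right ?_ (pairWeight_nonneg _ _ _ _)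
    rw [← (even_two_mul k).pow_abs (overlap σ τ)]
    gcongr
  · rw [mul_zero]
    exact mul_nonneg ((even_two_mul k).pow_nonneg _) (pairWeight_nonneg _ _ _ _)

/-- Disorder chaos: the annealed overlap tail is exponentially small. -/
lemma exists_overlapTail_le_exp (β : ℝ) {ε s : ℝ} (hε : 0 < ε) (hs0 : 0 ≤ s)
    (hs1 : s < 1) :
    ∃ c : ℝ, 0 < c ∧ ∀ᶠ n : ℕ in atTop, overlapTail n β ε s ≤ Real.exp (-c * n) := by
  obtain ⟨j, hj⟩ : ∃ j : ℕ, β ^ 2 * s ^ 2 ^ j ≤ 1 / 8 := by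
    obtain ⟨m, hm⟩ := exists_pow_lt_of_lt_one (show 0 < 1 / (8 * (β ^ 2 + 1)) by positivity) hs1
    refine ⟨m, ?_⟩
    have h1 : s ^ 2 ^ m ≤ 1 / (8 * (β ^ 2 + 1)) :=
      (pow_le_pow_of_le_one hs0 hs1.le Nat.lt_two_pow_self.le).trans hm.le
    calc β ^ 2 * s ^ 2 ^ m ≤ (β ^ 2 + 1) * (1 / (8 * (β ^ 2 + 1))) := by
          gcongr; linarith
      _ = 1 / 8 := by field_simp
  set D := 2 ^ j with hD
  have hDpos : 0 < D := by positivity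
  set δ : ℝ := ε ^ (2 * D) * Real.exp (-1) / 8 with hδ
  have hδpos : 0 < δ := by positivity
  refine ⟨δ / (2 * D), by positivity, ?_⟩
  filter_upwards [eventually_gt_atTop 0, eventually_ge_atTop ⌈4 / δ⌉₊] with n hn hn2
  have hn' : (0 : ℝ) < n := by exact_mod_cast hn
  have hn2' : 4 ≤ δ * n := by
    have : 4 / δ ≤ n := Nat.ceil_le.1 hn2
    rw [div_le_iff₀ hδpos] at this
    linarith
  set k := ⌊δ * n⌋₊ with hk
  have hk1 : (k : ℝ) ≤ δ * n := Nat.floor_le (by positivity)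
  have hk2 : δ * n < k + 1 := Nat.lt_floor_add_one _
  have hs' : 0 ≤ s ^ D := by positivity
  have hs1' : s ^ D ≤ 1 := pow_le_one₀ hs0 hs1.le
  have h1 := overlapMoment_pow_le hn β k hs0 hs1.le j
  have h2 := overlapMoment_le_expOverlap hn β k (s ^ D)
  have h3 := expOverlap_le_two hn hs' hs1' hj
  have h4 := pow_le_pow_left₀ (by have := overlapTail_nonneg n β ε s; positivity)
    (pow_mul_overlapTail_le n β hε.le k s) D
  have h5 : (8 * (k : ℝ) / n) ^ k ≤ (ε ^ (2 * D) * Real.exp (-1)) ^ k := by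
    gcongr
    rw [div_le_iff₀ hn']
    have : 8 * δ = ε ^ (2 * D) * Real.exp (-1) := by rw [hδ]; ring
    rw [← this]; linarith
  have h6 : (ε ^ (2 * k) * overlapTail n β ε s) ^ D ≤ (ε ^ (2 * D) * Real.exp (-1)) ^ k * 2 :=
    calc _ ≤ _ := h4
      _ ≤ _ := h1
      _ ≤ _ := h2
      _ ≤ _ := mul_le_mul h5 h3 (Finset.sum_nonneg fun _ _ => Finset.sum_nonneg fun _ _ =>
          mul_nonneg (Real.exp_pos _).le (pairWeight_nonneg _ _ _ _)) (by positivity)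
  have h7 : overlapTail n β ε s ^ D ≤ Real.exp (-1) ^ k * 2 := by
    rw [mul_pow, mul_pow, ← pow_mul, ← pow_mul, mul_right_comm,
      mul_assoc (ε ^ (2 * D * k))] at h6
    exact le_of_mul_le_mul_left h6 (by positivity)
  have h8 : Real.exp (-1) ^ k * 2 ≤ Real.exp (-(δ / (2 * D)) * n) ^ D := by
    have h2e : (2 : ℝ) ≤ Real.exp 1 := by linarith [Real.add_one_le_exp (1 : ℝ)]
    rw [← Real.exp_nat_mul, ← Real.exp_nat_mul]
    calc Real.exp (k * -1) * 2 ≤ Real.exp (k * -1) * Real.exp 1 := by gcongr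
      _ = Real.exp (1 - k) := by rw [← Real.exp_add]; congr 1; ring
      _ ≤ _ := by
        rw [Real.exp_le_exp]
        have : (D : ℝ) * (-(δ / (2 * D)) * n) = -(δ * n) / 2 := by
          have : (D : ℝ) ≠ 0 := by positivity
          field_simp
        rw [this]; linarith
  exact le_of_pow_le_pow_left₀ hDpos.ne' (Real.exp_pos _).le (h7.trans h8)

end Tail

section FreeEnergy

variable {n : ℕ}

lemma integral_Ham (σ : Fin n → Bool) : ∫ w, Ham w σ ∂(skMeasure n) = 0 := by
  have h0 : ∫ x, x ∂(skMeasure n) = 0 := integral_id_skMeasure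
  have h := IsGaussian.integral_dual (μ := skMeasure n) (HamL σ)
  rw [h0, map_zero] at h
  simpa [HamL_apply] using h

lemma map_Ham_skMeasure (hn : 0 < n) (σ : Fin n → Bool) :
    (skMeasure n).map (fun w => Ham w σ) = gaussianReal 0 (n / 2) := by
  have h := IsGaussian.map_eq_gaussianReal (μ := skMeasure n) (HamL σ)
  have e : ⇑(HamL σ) = fun w => Ham w σ := funext fun w => HamL_apply σ w
  have hv : Var[fun w => Ham w σ; skMeasure n] = n / 2 := by
    rw [variance_of_integral_eq_zero (continuous_Ham σ).aemeasurable (integral_Ham σ)]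
    simp_rw [sq, integral_Ham_mul_Ham, spin_mul_self]
    simp only [Finset.sum_const, Finset.card_univ, Fintype.card_fin, nsmul_eq_mul, mul_one]
    field_simp
  rw [e, integral_Ham, hv] at h
  rw [h]
  congr
  ext
  rw [Real.coe_toNNReal _ (by positivity)]
  simp

lemma integral_exp_Ham (hn : 0 < n) (β : ℝ) (σ : Fin n → Bool) :
    Integrable (fun w => Real.exp (-β * Ham w σ)) (skMeasure n) ∧
    ∫ w, Real.exp (-β * Ham w σ) ∂(skMeasure n) = Real.exp (β ^ 2 * n / 4) := by
  constructor
  · have h := integrable_exp_mul_gaussianReal (μ := 0) (v := (n / 2 : NNReal)) (-β)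
    rw [← map_Ham_skMeasure hn σ] at h
    exact h.comp_measurable (continuous_Ham σ).measurable
  · have h := mgf_gaussianReal (map_Ham_skMeasure hn σ) (-β)
    rw [mgf] at h
    rw [h]
    congr 1
    push_cast
    ring

lemma log_le_log_add (x : ℝ) (hx : 0 < x) (a : ℝ) : Real.log x ≤ a + x * Real.exp (-a) - 1 := by
  have h := Real.log_le_sub_one_of_pos (mul_pos hx (Real.exp_pos (-a)))
  rw [Real.log_mul hx.ne' (Real.exp_pos _).ne', Real.log_exp] at h
  linarith

lemma exp_le_Zpart (β : ℝ) (X : Fin n → Fin n → ℝ) (σ : Fin n → Bool) :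
    Real.exp (-β * Ham X σ) ≤ Zpart β X :=
  Finset.single_le_sum (f := fun σ => Real.exp (-β * Ham X σ)) (fun _ _ => (Real.exp_pos _).le)
    (Finset.mem_univ σ)

lemma integrable_Ham (σ : Fin n → Bool) : Integrable (fun w => Ham w σ) (skMeasure n) := by
  simp_rw [← HamL_apply]
  exact IsGaussian.integrable_dual _ _

lemma integrable_Zpart (hn : 0 < n) (β : ℝ) : Integrable (fun w => Zpart β w) (skMeasure n) :=
  integrable_finsetSum _ fun σ _ => (integral_exp_Ham hn β σ).1

lemma integrable_log_Zpart (hn : 0 < n) (β : ℝ) :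
    Integrable (fun w => Real.log (Zpart β w)) (skMeasure n) := by
  refine Integrable.mono' ((integrable_Zpart hn β).add
    ((integrable_Ham (fun _ => true)).const_mul (-β)).abs)
    ((continuous_Zpart β).log fun w => (Zpart_pos β w).ne').aestronglyMeasurable
    (ae_of_all _ fun w => ?_)
  rw [Real.norm_eq_abs, abs_le]
  have h1 := Real.log_le_sub_one_of_pos (Zpart_pos β w)
  have h2 := Real.log_le_log (Real.exp_pos _) (exp_le_Zpart β w fun _ => true)
  rw [Real.log_exp] at h2
  have h3 := Zpart_pos β w
  have h4 := neg_abs_le (-β * Ham w fun _ => true)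
  have h5 := abs_nonneg (-β * Ham w fun _ => true)
  simp only [Pi.add_apply]
  constructor <;> linarith

/-- The annealed bound on the free energy. -/
lemma integral_log_Zpart_le (hn : 0 < n) (β : ℝ) :
    ∫ w, Real.log (Zpart β w) ∂(skMeasure n) ≤ n * (Real.log 2 + β ^ 2 / 4) := by
  set a := (n : ℝ) * (Real.log 2 + β ^ 2 / 4) with ha
  have hZ : ∫ w, Zpart β w ∂(skMeasure n) = Real.exp a := by
    unfold Zpart
    rw [integral_finsetSum _ fun σ _ => (integral_exp_Ham hn β σ).1]
    simp_rw [(integral_exp_Ham hn β _).2]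
    simp only [Finset.sum_const, Finset.card_univ, Fintype.card_fun, Fintype.card_bool,
      Fintype.card_fin, nsmul_eq_mul, Nat.cast_pow, Nat.cast_ofNat]
    rw [ha, mul_add, Real.exp_add, Real.exp_nat_mul, Real.exp_log (by norm_num)]
    congr 2
    ring
  have hi : Integrable (fun w => a + Zpart β w * Real.exp (-a)) (skMeasure n) :=
    (integrable_const a).add ((integrable_Zpart hn β).mul_const _)
  calc _ ≤ ∫ w, (a + Zpart β w * Real.exp (-a) - 1) ∂(skMeasure n) :=
        integral_mono (integrable_log_Zpart hn β) (hi.sub' (integrable_const 1))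
          fun w => log_le_log_add _ (Zpart_pos β w) a
    _ = a := by
        rw [integral_sub hi (integrable_const 1), integral_add (integrable_const a)
          ((integrable_Zpart hn β).mul_const _), integral_mul_const (Real.exp (-a)), hZ,
          ← Real.exp_add]
        simp

lemma abs_overlap_le_one (σ τ : Fin n → Bool) : |overlap σ τ| ≤ 1 := by
  unfold overlap
  rw [abs_mul, abs_of_nonneg (by positivity)]
  have h : |∑ i, spin (σ i) * spin (τ i)| ≤ n := by
    refine (Finset.abs_sum_le_sum_abs _ _).trans ?_
    simp [abs_mul, abs_spin]
  rw [one_div_mul_eq_div]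
  exact div_le_one_of_le₀ h (by positivity)

lemma overlap_self (hn : 0 < n) (σ : Fin n → Bool) : overlap σ σ = 1 := by
  have : (n : ℝ) ≠ 0 := by positivity
  simp [overlap, spin_mul_self, this]

lemma Zres_Icc (β : ℝ) (X Y : Fin n → Fin n → ℝ) :
    Zres β (Set.Icc (-1 : ℝ) 1) X Y = Zpart β X * Zpart β Y := by
  unfold Zres Zpart
  rw [Finset.sum_mul_sum]
  refine Finset.sum_congr rfl fun σ _ => Finset.sum_congr rfl fun τ _ => ?_
  rw [if_pos (show overlap σ τ ∈ Set.Icc (-1 : ℝ) 1 from abs_le.1 (abs_overlap_le_one σ τ)),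
    ← Real.exp_add]
  congr 1
  ring

lemma mem_Icc_union_Icc_iff {r ε : ℝ} (hr : |r| ≤ 1) :
    r ∈ Set.Icc (-1 : ℝ) (-ε) ∪ Set.Icc ε 1 ↔ ε ≤ |r| := by
  rw [abs_le] at hr
  rw [le_abs]
  constructor
  · rintro (h | h)
    · exact Or.inr (by linarith [h.2])
    · exact Or.inl h.1
  · rintro (h | h)
    · exact Or.inr ⟨h, hr.2⟩
    · exact Or.inl ⟨hr.1, by linarith⟩

open scoped Classical in
/-- The Gibbs probability that the overlap is at least `ε` in absolute value. -/
noncomputable def gibbsTail (β ε : ℝ) (X Y : Fin n → Fin n → ℝ) : ℝ :=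
  ∑ σ : Fin n → Bool, ∑ τ : Fin n → Bool,
    if ε ≤ |overlap σ τ| then gibbs β X σ * gibbs β Y τ else 0

lemma Zres_eq_mul (β ε : ℝ) (X Y : Fin n → Fin n → ℝ) :
    Zres β (Set.Icc (-1 : ℝ) (-ε) ∪ Set.Icc ε 1) X Y =
      Zpart β X * Zpart β Y * gibbsTail β ε X Y := by
  unfold Zres gibbsTail
  rw [Finset.mul_sum]
  refine Finset.sum_congr rfl fun σ _ => ?_
  rw [Finset.mul_sum]
  refine Finset.sum_congr rfl fun τ _ => ?_
  simp only [mem_Icc_union_Icc_iff (abs_overlap_le_one σ τ)]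
  split_ifs
  · have h1 := (Zpart_pos β X).ne'
    have h2 := (Zpart_pos β Y).ne'
    rw [gibbs, gibbs, mul_add, Real.exp_add]
    field_simp
  · simp

lemma gibbs_mul_gibbs_le_gibbsTail (hn : 0 < n) (β : ℝ) {ε : ℝ} (hε : ε ≤ 1)
    (X Y : Fin n → Fin n → ℝ) (σ : Fin n → Bool) :
    gibbs β X σ * gibbs β Y σ ≤ gibbsTail β ε X Y := by
  have hnn := fun σ τ => (mul_pos (gibbs_pos β X σ) (gibbs_pos β Y τ)).le
  refine le_trans (le_trans (le_of_eq ?_) (Finset.single_le_sum (fun τ _ => ?_)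
    (Finset.mem_univ σ))) (Finset.single_le_sum (fun σ _ => Finset.sum_nonneg fun τ _ => ?_)
    (Finset.mem_univ σ))
  · rw [if_pos]
    rwa [overlap_self hn, abs_one]
  all_goals
    split_ifs
    exacts [hnn _ _, le_rfl]

lemma gibbsTail_le_one (β ε : ℝ) (X Y : Fin n → Fin n → ℝ) : gibbsTail β ε X Y ≤ 1 := by
  calc gibbsTail β ε X Y ≤ ∑ σ, ∑ τ, gibbs β X σ * gibbs β Y τ := by
        refine Finset.sum_le_sum fun σ _ => Finset.sum_le_sum fun τ _ => ?_
        split_ifs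
        exacts [le_rfl, (mul_pos (gibbs_pos β X σ) (gibbs_pos β Y τ)).le]
    _ = 1 := by rw [← Finset.sum_mul_sum, sum_gibbs, sum_gibbs, one_mul]

lemma gibbsTail_pos (hn : 0 < n) (β : ℝ) {ε : ℝ} (hε : ε ≤ 1) (X Y : Fin n → Fin n → ℝ) :
    0 < gibbsTail β ε X Y :=
  (mul_pos (gibbs_pos β X fun _ => true) (gibbs_pos β Y fun _ => true)).trans_le
    (gibbs_mul_gibbs_le_gibbsTail hn β hε X Y _)

lemma continuous_gibbsTail (β ε : ℝ) :
    Continuous fun p : (Fin n → Fin n → ℝ) × (Fin n → Fin n → ℝ) => gibbsTail β ε p.1 p.2 := by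
  refine continuous_finsetSum _ fun σ _ => continuous_finsetSum _ fun τ _ => ?_
  split_ifs
  · exact ((continuous_gibbs β σ).comp continuous_fst).mul
      ((continuous_gibbs β τ).comp continuous_snd)
  · exact continuous_const

lemma neg_mul_Ham_add_Ham_le_log (hn : 0 < n) (β : ℝ) {ε : ℝ} (hε : ε ≤ 1)
    (X Y : Fin n → Fin n → ℝ) (σ : Fin n → Bool) :
    -β * (Ham X σ + Ham Y σ) ≤
      Real.log (Zpart β X) + Real.log (Zpart β Y) + Real.log (gibbsTail β ε X Y) := by
  have hX := Zpart_pos β X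
  have hY := Zpart_pos β Y
  rw [← Real.log_mul hX.ne' hY.ne',
    ← Real.log_mul (mul_pos hX hY).ne' (gibbsTail_pos hn β hε X Y).ne']
  refine (Real.le_log_iff_exp_le (mul_pos (mul_pos hX hY) (gibbsTail_pos hn β hε X Y))).2 ?_
  calc _ = Zpart β X * Zpart β Y * (gibbs β X σ * gibbs β Y σ) := by
        rw [gibbs, gibbs, mul_add, Real.exp_add]
        field_simp
    _ ≤ _ := mul_le_mul_of_nonneg_left (gibbs_mul_gibbs_le_gibbsTail hn β hε X Y σ)
        (mul_pos hX hY).le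

end FreeEnergy

section Gap

variable {n : ℕ}

lemma integrable_rotation {f : (Fin n → Fin n → ℝ) → ℝ} (hf : Integrable f (skMeasure n))
    (θ : ℝ) : Integrable (fun p : (Fin n → Fin n → ℝ) × (Fin n → Fin n → ℝ) =>
      f (Real.cos θ • p.1 + Real.sin θ • p.2)) ((skMeasure n).prod (skMeasure n)) := by
  have hmp : MeasurePreserving (ContinuousLinearMap.rotation θ)
      ((skMeasure n).prod (skMeasure n)) ((skMeasure n).prod (skMeasure n)) :=
    ⟨by fun_prop, map_rotation_skMeasure θ⟩
  have h := hmp.integrable_comp_of_integrable (hf.comp_fst (skMeasure n))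
  simpa [Function.comp_def, ContinuousLinearMap.rotation_apply] using h

lemma integral_rotation {f : (Fin n → Fin n → ℝ) → ℝ} (hf : Continuous f) (θ : ℝ) :
    ∫ p, f (Real.cos θ • p.1 + Real.sin θ • p.2) ∂((skMeasure n).prod (skMeasure n)) =
      ∫ w, f w ∂(skMeasure n) := by
  have h := integral_comp_rotation (μ := skMeasure n) map_rotation_skMeasure θ
    (f := fun p => f p.1) (Continuous.stronglyMeasurable (by fun_prop))
  simp only [ContinuousLinearMap.rotation_apply] at h
  rw [h, integral_fun_fst]
  simp

open scoped Classical in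
lemma integral_gibbsTail (β ε s : ℝ) :
    ∫ p, gibbsTail β ε p.1 (Real.cos (Real.arccos s) • p.1 + Real.sin (Real.arccos s) • p.2)
      ∂((skMeasure n).prod (skMeasure n)) = overlapTail n β ε s := by
  unfold gibbsTail overlapTail
  have hi : ∀ σ τ : Fin n → Bool, Integrable (fun p : (Fin n → Fin n → ℝ) × (Fin n → Fin n → ℝ) =>
      if ε ≤ |overlap σ τ| then gibbs β p.1 σ * gibbs β
        (Real.cos (Real.arccos s) • p.1 + Real.sin (Real.arccos s) • p.2) τ else 0)
      ((skMeasure n).prod (skMeasure n)) := by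
    intro σ τ
    split_ifs
    exacts [integrable_gibbs_mul_gibbs β _ σ τ, integrable_zero _ _ _]
  rw [integral_finsetSum _ fun σ _ => integrable_finsetSum _ fun τ _ => hi σ τ]
  refine Finset.sum_congr rfl fun σ _ => ?_
  rw [integral_finsetSum _ fun τ _ => hi σ τ]
  refine Finset.sum_congr rfl fun τ _ => ?_
  split_ifs
  · rfl
  · simp

/-- Bounds on the difference of the restricted and unrestricted free energies. -/
lemma integral_log_Zres_sub_bounds (hn : 0 < n) (β : ℝ) {ε s c : ℝ} (hε : ε ≤ 1)
    (hc : overlapTail n β ε s ≤ Real.exp (-c * n)) {Y : (Fin n → Fin n → ℝ) ×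
      (Fin n → Fin n → ℝ) → Fin n → Fin n → ℝ}
    (hY : ∀ p, Y p = Real.cos (Real.arccos s) • p.1 + Real.sin (Real.arccos s) • p.2) :
    -(2 * (n * (Real.log 2 + β ^ 2 / 4))) ≤
        ∫ p, Real.log (Zres β (Set.Icc (-1 : ℝ) (-ε) ∪ Set.Icc ε 1) p.1 (Y p)) ∂(skPair n) -
          ∫ p, Real.log (Zres β (Set.Icc (-1 : ℝ) 1) p.1 (Y p)) ∂(skPair n) ∧
      ∫ p, Real.log (Zres β (Set.Icc (-1 : ℝ) (-ε) ∪ Set.Icc ε 1) p.1 (Y p)) ∂(skPair n) -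
          ∫ p, Real.log (Zres β (Set.Icc (-1 : ℝ) 1) p.1 (Y p)) ∂(skPair n) ≤ -c * n := by
  have hYc : Continuous Y := by rw [funext hY]; fun_prop
  have hlogc : Continuous fun w : Fin n → Fin n → ℝ => Real.log (Zpart β w) :=
    (continuous_Zpart β).log fun w => (Zpart_pos β w).ne'
  have hqpos := fun p : (Fin n → Fin n → ℝ) × (Fin n → Fin n → ℝ) =>
    gibbsTail_pos hn β hε p.1 (Y p)
  have hqc : Continuous fun p => gibbsTail β ε p.1 (Y p) :=
    (continuous_gibbsTail β ε).comp (continuous_fst.prodMk hYc)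
  have hlq0 : ∀ p, Real.log (gibbsTail β ε p.1 (Y p)) ≤ 0 := fun p =>
    Real.log_nonpos (hqpos p).le (gibbsTail_le_one _ _ _ _)
  have e1 : ∀ p, Real.log (Zres β (Set.Icc (-1 : ℝ) (-ε) ∪ Set.Icc ε 1) p.1 (Y p)) =
      Real.log (Zpart β p.1) + Real.log (Zpart β (Y p)) +
        Real.log (gibbsTail β ε p.1 (Y p)) := fun p => by
    rw [Zres_eq_mul, Real.log_mul (mul_pos (Zpart_pos _ _) (Zpart_pos _ _)).ne' (hqpos p).ne',
      Real.log_mul (Zpart_pos _ _).ne' (Zpart_pos _ _).ne']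
  have e2 : ∀ p, Real.log (Zres β (Set.Icc (-1 : ℝ) 1) p.1 (Y p)) =
      Real.log (Zpart β p.1) + Real.log (Zpart β (Y p)) := fun p => by
    rw [Zres_Icc, Real.log_mul (Zpart_pos _ _).ne' (Zpart_pos _ _).ne']
  simp_rw [e1, e2, skPair]
  have iZ1 : Integrable (fun p => Real.log (Zpart β p.1)) ((skMeasure n).prod (skMeasure n)) :=
    (integrable_log_Zpart hn β).comp_fst (skMeasure n)
  have iZ2 : Integrable (fun p => Real.log (Zpart β (Y p))) ((skMeasure n).prod (skMeasure n)) := by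
    simp_rw [hY]; exact integrable_rotation (integrable_log_Zpart hn β) _
  have iH1 : Integrable (fun p => Ham p.1 fun _ => true) ((skMeasure n).prod (skMeasure n)) :=
    (integrable_Ham fun _ => true).comp_fst (skMeasure n)
  have iH2 : Integrable (fun p => Ham (Y p) fun _ => true)
      ((skMeasure n).prod (skMeasure n)) := by
    simp_rw [hY]; exact integrable_rotation (integrable_Ham _) _
  have iZ : Integrable (fun p => Real.log (Zpart β p.1) + Real.log (Zpart β (Y p)))
      ((skMeasure n).prod (skMeasure n)) := iZ1.add iZ2
  have iH : Integrable (fun p => -β * ((Ham p.1 fun _ => true) + Ham (Y p) fun _ => true))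
      ((skMeasure n).prod (skMeasure n)) := (iH1.add iH2).const_mul _
  have hlow := fun p : (Fin n → Fin n → ℝ) × (Fin n → Fin n → ℝ) =>
    neg_mul_Ham_add_Ham_le_log hn β hε p.1 (Y p) fun _ => true
  have iq : Integrable (fun p => Real.log (gibbsTail β ε p.1 (Y p)))
      ((skMeasure n).prod (skMeasure n)) := by
    refine (iH.sub' iZ).mono (hqc.log fun p => (hqpos p).ne').aestronglyMeasurable
      (ae_of_all _ fun p => ?_)
    have h1 := hlow p
    have h2 := hlq0 p
    rw [Real.norm_eq_abs, Real.norm_eq_abs, abs_of_nonpos h2]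
    exact le_trans (by linarith) (neg_le_abs _)
  have hZ : ∫ p, (Real.log (Zpart β p.1) + Real.log (Zpart β (Y p)))
      ∂((skMeasure n).prod (skMeasure n)) ≤ 2 * (n * (Real.log 2 + β ^ 2 / 4)) := by
    have h1 := integral_fun_fst (μ := skMeasure n) (ν := skMeasure n)
      (fun w : Fin n → Fin n → ℝ => Real.log (Zpart β w))
    have h2 := integral_rotation hlogc (Real.arccos s)
    simp_rw [← hY] at h2
    rw [integral_add iZ1 iZ2, h1, h2]
    simp only [probReal_univ, one_smul]
    linarith [integral_log_Zpart_le hn β]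
  have hH : ∫ p, (-β * ((Ham p.1 fun _ => true) + Ham (Y p) fun _ => true))
      ∂((skMeasure n).prod (skMeasure n)) = 0 := by
    have h1 := integral_fun_fst (μ := skMeasure n) (ν := skMeasure n)
      (fun w : Fin n → Fin n → ℝ => Ham w fun _ => true)
    have h2 := integral_rotation (continuous_Ham (n := n) fun _ => true) (Real.arccos s)
    simp_rw [← hY] at h2
    rw [integral_const_mul, integral_add iH1 iH2, h1, h2]
    simp [integral_Ham]
  have h0 : 0 ≤ ∫ p, (Real.log (Zpart β p.1) + Real.log (Zpart β (Y p)) +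
      Real.log (gibbsTail β ε p.1 (Y p))) ∂((skMeasure n).prod (skMeasure n)) := by
    rw [← hH]
    exact integral_mono iH (iZ.add iq) hlow
  refine ⟨by linarith, ?_⟩
  rw [integral_add iZ iq, add_sub_cancel_left]
  have hi : Integrable (fun p => gibbsTail β ε p.1 (Y p) * Real.exp (-(-c * n)))
      ((skMeasure n).prod (skMeasure n)) :=
    (integrable_of_continuous_of_abs_le hqc (C := 1) fun p => by
      rw [abs_of_pos (hqpos p)]; exact gibbsTail_le_one _ _ _ _).mul_const _
  have hi' : Integrable (fun p => -c * n + gibbsTail β ε p.1 (Y p) * Real.exp (-(-c * n)))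
      ((skMeasure n).prod (skMeasure n)) := (integrable_const _).add hi
  calc _ ≤ ∫ p, (-c * n + gibbsTail β ε p.1 (Y p) * Real.exp (-(-c * n)) - 1)
        ∂((skMeasure n).prod (skMeasure n)) :=
        integral_mono iq (hi'.sub' (integrable_const 1))
          fun p => log_le_log_add _ (hqpos p) (-c * n)
    _ = -c * n + overlapTail n β ε s * Real.exp (-(-c * n)) - 1 := by
        rw [integral_sub hi' (integrable_const 1), integral_add (integrable_const _) hi,
          integral_mul_const (Real.exp (-(-c * n))), ← integral_gibbsTail β ε s]
        simp_rw [hY]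
        simp
    _ ≤ -c * n + Real.exp (-c * n) * Real.exp (-(-c * n)) - 1 := by gcongr
    _ = -c * n := by rw [← Real.exp_add]; simp

end Gap

/-- free-energy gap between the overlap-restricted and
unrestricted coupled SK systems. -/
theorem stmt_9 (β t ε : ℝ) (ht0 : 0 < t) (ht1 : t ≤ 1) (hε0 : 0 < ε) (hε1 : ε < 1) :
    ∃ K : ℝ, 0 < K ∧
      limsup (fun n : ℕ =>
        (1 / (n : ℝ)) *
          (∫ p, Real.log (Zres β (Set.Icc (-1 : ℝ) (-ε) ∪ Set.Icc ε 1) p.1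
            (skPerturb t p.1 p.2)) ∂(skPair n)) -
        (1 / (n : ℝ)) *
          ∫ p, Real.log (Zres β (Set.Icc (-1 : ℝ) 1) p.1
            (skPerturb t p.1 p.2)) ∂(skPair n)) atTop
      ≤ -(1 / K) := by
  have hs0 : 0 ≤ √(1 - t) := Real.sqrt_nonneg _
  have hs1 : √(1 - t) < 1 := by
    rw [Real.sqrt_lt' one_pos]; linarith
  obtain ⟨c, hc, htail⟩ := exists_overlapTail_le_exp β hε0 hs0 hs1
  have hY : ∀ {n : ℕ} (p : (Fin n → Fin n → ℝ) × (Fin n → Fin n → ℝ)), skPerturb t p.1 p.2 =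
      Real.cos (Real.arccos √(1 - t)) • p.1 + Real.sin (Real.arccos √(1 - t)) • p.2 := by
    intro n p
    rw [Real.cos_arccos (by linarith) hs1.le, Real.sin_arccos, Real.sq_sqrt (by linarith),
      sub_sub_cancel]
    rfl
  refine ⟨1 / c, by positivity, ?_⟩
  rw [one_div_one_div]
  refine limsup_le_of_le (IsBoundedUnder.isCoboundedUnder_le
    (isBoundedUnder_of_eventually_ge (a := -(2 * (Real.log 2 + β ^ 2 / 4))) ?_)) ?_
  all_goals
    filter_upwards [htail, eventually_gt_atTop 0] with n h hn
    have hn' : (0 : ℝ) < n := by exact_mod_cast hn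
    obtain ⟨hl, hu⟩ := integral_log_Zres_sub_bounds hn β hε1.le h hY
    rw [← mul_sub, one_div_mul_eq_div]
  · rw [le_div_iff₀ hn']
    linarith
  · rwa [div_le_iff₀ hn']
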